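/- arXiv:math/0608410 — 3 statements merged into one kernel-verified Lean document; each statement's English description precedes it below -/
import Mathlib

section
/- Let δ ∈ (0, π/2), M > 2, let r₁ ≥ 1 be an integer, and let Ω ∈ ℝ be arbitrary. For each positive integer r set x_r = r·e^{iΩ/√r} and define g(r) = (1/2) ∫_{[0, M e^{iδ}]} e^{−p x_r} (1 − p)^{−(r+r₁)} dp + (1/2) ∫_{[0, M e^{−iδ}]} e^{−p x_r} (1 − p)^{−(r+r₁)} dp, the integrals being taken along the straight segments from 0 to M e^{±iδ}. Then lim_{r→∞} √r · e^{−Ω²/2} · g(r) = i·√(π/2)·erf(Ω/√2). In particular, as Ω varies over ℝ the limit interpolates smoothly, via the error function, between the values at Ω = ∓∞. -/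
open MeasureTheory Real

/-- The error function `erf(y) = (2/√π) ∫_0^y e^{-t²} dt`. -/
noncomputable def erf (y : ℝ) : ℝ :=
  (2 / Real.sqrt π) * ∫ t in (0 : ℝ)..y, Real.exp (-t ^ 2)


lemma aux_contour (δ M : ℝ) (hδ : δ ∈ Set.Ioo 0 (π / 2)) (hM : 2 < M) (f : ℂ → ℂ)
    (hf : ∀ z : ℂ, z ≠ 1 → DifferentiableAt ℂ f z) (C : ℝ)
    (hC : ∀ φ ∈ Set.Icc δ (π/2), ‖f (M * Complex.exp (Complex.I * φ))‖ ≤ C) :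
    ‖(∫ t in (0:ℝ)..M, f (t * Complex.exp (Complex.I * δ)) * Complex.exp (Complex.I * δ)) -
      ∫ t in (0:ℝ)..M, f (t * Complex.I) * Complex.I‖ ≤ C * M * (π/2 - δ) := by
  obtain ⟨h0, h1⟩ := hδ
  have hs : 0 < Real.sin δ := Real.sin_pos_of_pos_of_lt_pi h0 (by linarith [Real.pi_pos])
  set L : ℂ →ₗ[ℝ] ℝ := Real.cos δ • Complex.imLm - Real.sin δ • Complex.reLm with hL
  have hLz : ∀ z : ℂ, L z = Real.cos δ * z.im - Real.sin δ * z.re := by intro z; simp [hL]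
  set S : Set ℂ := {z | -Real.sin δ < L z} with hS
  have hconv : Convex ℝ S := convex_halfSpace_gt L.isLinear _
  have hopen : IsOpen S := by
    simp only [hS, hLz]
    exact isOpen_lt (by fun_prop) (by fun_prop)
  have hS1 : ∀ z ∈ S, z ≠ 1 := by
    rintro z hz rfl
    simp [hS, hLz] at hz
  obtain ⟨F, hF⟩ := hconv.exists_forall_hasDerivWithinAt
    (fun z hz => (hf z (hS1 z hz)).differentiableWithinAt)
  have hF' : ∀ z ∈ S, HasDerivAt F (f z) z := fun z hz => (hF z hz).hasDerivAt (hopen.mem_nhds hz)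
  have hmem : ∀ t : ℝ, 0 ≤ t → ∀ φ ∈ Set.Icc δ (π/2), (t:ℂ) * Complex.exp (Complex.I * φ) ∈ S := by
    intro t ht φ hφ
    have : 0 ≤ Real.sin (φ - δ) :=
      Real.sin_nonneg_of_nonneg_of_le_pi (by linarith [hφ.1]) (by linarith [hφ.2])
    rw [Real.sin_sub] at this
    have e1 : ((t:ℂ) * Complex.exp (Complex.I * φ)).re = t * Real.cos φ := by
      rw [mul_comm Complex.I, Complex.re_ofReal_mul, Complex.exp_ofReal_mul_I_re]
    have e2 : ((t:ℂ) * Complex.exp (Complex.I * φ)).im = t * Real.sin φ := by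
      rw [mul_comm Complex.I, Complex.im_ofReal_mul, Complex.exp_ofReal_mul_I_im]
    simp only [hS, Set.mem_ofPred_eq, hLz, e1, e2]
    nlinarith [mul_nonneg ht this]
  have key : ∀ φ ∈ Set.Icc δ (π/2), (∫ t in (0:ℝ)..M, f (t * Complex.exp (Complex.I * φ)) *
      Complex.exp (Complex.I * φ)) = F (M * Complex.exp (Complex.I * φ)) - F 0 := by
    intro φ hφ
    have := intervalIntegral.integral_eq_sub_of_hasDerivAt (a := 0) (b := M)
      (f := fun t : ℝ => F (t * Complex.exp (Complex.I * φ)))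
      (f' := fun t : ℝ => f (t * Complex.exp (Complex.I * φ)) * Complex.exp (Complex.I * φ)) ?_ ?_
    · simpa using this
    · intro t ht
      rw [Set.uIcc_of_le (by linarith)] at ht
      have h2 : HasDerivAt (fun t : ℝ => (t:ℂ) * Complex.exp (Complex.I * φ))
          (1 * Complex.exp (Complex.I * φ)) t :=
        (Complex.ofRealCLM.hasDerivAt (x := t)).mul_const _
      rw [one_mul] at h2
      exact (hF' _ (hmem t ht.1 φ hφ)).comp t h2
    · apply ContinuousOn.intervalIntegrable
      intro t ht
      rw [Set.uIcc_of_le (by linarith)] at ht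
      have h3 := (hf _ (hS1 _ (hmem t ht.1 φ hφ))).continuousAt
      apply ContinuousAt.continuousWithinAt
      refine ContinuousAt.mul ?_ continuousAt_const
      exact ContinuousAt.comp (f := fun t : ℝ => (t:ℂ) * Complex.exp (Complex.I * φ)) h3 (by fun_prop)
  have k1 := key δ ⟨le_rfl, h1.le⟩
  have k2 := key (π/2) ⟨h1.le, le_rfl⟩
  have eI : Complex.exp (Complex.I * (π/2 : ℝ)) = Complex.I := by
    rw [mul_comm]; push_cast; exact Complex.exp_pi_div_two_mul_I
  rw [k1]
  rw [eI] at k2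
  rw [k2]
  have := norm_image_sub_le_of_norm_deriv_le_segment' (a := δ) (b := π/2) (C := C * M)
    (f := fun φ : ℝ => F (M * Complex.exp (Complex.I * φ)))
    (f' := fun φ : ℝ => f (M * Complex.exp (Complex.I * φ)) * (M * (Complex.exp (Complex.I * φ) * Complex.I))) ?_ ?_ (π/2) ⟨h1.le, le_rfl⟩
  · rw [eI] at this
    rw [norm_sub_rev, sub_sub_sub_cancel_right]
    exact this
  · intro φ hφ
    have h2 : HasDerivAt (fun φ : ℝ => (M:ℂ) * Complex.exp (Complex.I * φ))
        (M * (Complex.exp (Complex.I * φ) * (Complex.I * 1))) φ := by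
      refine HasDerivAt.const_mul _ (HasDerivAt.cexp ?_)
      exact (Complex.ofRealCLM.hasDerivAt (x := φ)).const_mul _
    rw [mul_one] at h2
    exact ((hF' _ (hmem M (by linarith) φ hφ)).comp φ h2).hasDerivWithinAt
  · intro φ hφ
    have := hC φ ⟨hφ.1, hφ.2.le⟩
    rw [norm_mul, norm_mul, norm_mul, Complex.norm_I, mul_comm Complex.I, Complex.norm_exp_ofReal_mul_I,
      Complex.norm_real, Real.norm_of_nonneg (by linarith), mul_comm _ Complex.I, mul_one, mul_one]
    exact mul_le_mul_of_nonneg_right this (by linarith)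

lemma aux_x (Ω : ℝ) (r : ℕ) (p : ℂ) (hp : 0 ≤ p.re) :
    ‖Complex.exp (-p * ((r : ℂ) * Complex.exp (Complex.I * (Ω / Real.sqrt r))))‖
      ≤ Real.exp (‖p‖ * |Ω| * Real.sqrt r) := by
  rw [Complex.norm_exp]
  apply Real.exp_le_exp.2
  have h : -p * ((r : ℂ) * Complex.exp (Complex.I * (Ω / Real.sqrt r))) =
    -((r:ℝ) * p) - ((r:ℝ) * (p * (Complex.exp (Complex.I * (Ω / Real.sqrt r : ℝ)) - 1))) := by
    push_cast; ring
  rw [h, Complex.sub_re, Complex.neg_re, Complex.re_ofReal_mul, Complex.re_ofReal_mul]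
  have h2 : -(p * (Complex.exp (Complex.I * (Ω / Real.sqrt r : ℝ)) - 1)).re ≤ ‖p‖ * |Ω / Real.sqrt r| := by
    refine (neg_le_abs _).trans ((Complex.abs_re_le_norm _).trans ?_)
    rw [norm_mul]
    exact mul_le_mul_of_nonneg_left Real.norm_exp_I_mul_ofReal_sub_one_le (norm_nonneg _)
  have h3 : (r:ℝ) * (‖p‖ * |Ω / Real.sqrt r|) = ‖p‖ * |Ω| * Real.sqrt r := by
    rw [abs_div, abs_of_nonneg (Real.sqrt_nonneg _)]
    rcases Nat.eq_zero_or_pos r with rfl | hr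
    · simp
    · have : 0 < Real.sqrt r := Real.sqrt_pos.2 (by exact_mod_cast hr)
      have h4 := Real.mul_self_sqrt (Nat.cast_nonneg r : (0:ℝ) ≤ r)
      field_simp
      rw [sq, h4]
      ring
  have h5 : (0:ℝ) ≤ r := Nat.cast_nonneg r
  nlinarith [mul_le_mul_of_nonneg_left h2 h5, mul_nonneg h5 hp]

lemma aux_arc (M : ℝ) (hM : 2 < M) (r₁ : ℕ) (Ω : ℝ) (r : ℕ) (p : ℂ) (hp : 0 ≤ p.re) (hpM : ‖p‖ = M) :
    ‖Complex.exp (-p * ((r : ℂ) * Complex.exp (Complex.I * (Ω / Real.sqrt r)))) *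
      (1 - p) ^ (-((r : ℤ) + r₁))‖ ≤ Real.exp (M * |Ω| * Real.sqrt r - Real.log (M - 1) * r) := by
  have h1 := aux_x Ω r p hp
  rw [hpM] at h1
  have h2 : M - 1 ≤ ‖1 - p‖ := by
    have := norm_sub_norm_le p 1
    rw [norm_sub_rev, hpM, norm_one] at this
    exact this
  rw [norm_mul, sub_eq_add_neg (M * |Ω| * Real.sqrt r), Real.exp_add]
  refine mul_le_mul h1 ?_ (norm_nonneg _) (Real.exp_pos _).le
  rw [Real.exp_neg, mul_comm, Real.exp_nat_mul, Real.exp_log (by linarith), norm_zpow, zpow_neg]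
  apply inv_anti₀ (by apply pow_pos; linarith)
  have : ((r:ℤ) + r₁) = ((r + r₁ : ℕ) : ℤ) := by push_cast; rfl
  rw [this, zpow_natCast]
  calc (M-1)^r ≤ (M-1)^(r+r₁) := pow_le_pow_right₀ (by linarith) (by omega)
    _ ≤ _ := pow_le_pow_left₀ (by linarith) h2 _

lemma aux_decay (a b K : ℝ) (hb : 0 < b) :
    Filter.Tendsto (fun r : ℕ => Real.sqrt r * (Real.exp (a * Real.sqrt r - b * r) * K))
      Filter.atTop (nhds 0) := by
  have hu : Filter.Tendsto (fun r : ℕ => Real.sqrt r) Filter.atTop Filter.atTop :=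
    Real.tendsto_sqrt_atTop.comp tendsto_natCast_atTop_atTop
  have h1 : Filter.Tendsto (fun u : ℝ => u ^ 1 * Real.exp (-u)) Filter.atTop (nhds 0) :=
    Real.tendsto_pow_mul_exp_neg_atTop_nhds_zero 1
  have h2 : Filter.Tendsto (fun u : ℝ => u * Real.exp (a * u - b * u^2)) Filter.atTop (nhds 0) := by
    refine squeeze_zero' ?_ ?_ h1
    · filter_upwards [Filter.eventually_ge_atTop 0] with u hu
      positivity
    · filter_upwards [Filter.eventually_ge_atTop 0, Filter.eventually_ge_atTop ((a+1)/b)] with u hu hu2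
      rw [pow_one]
      apply mul_le_mul_of_nonneg_left _ hu
      apply Real.exp_le_exp.2
      rw [div_le_iff₀ hb] at hu2
      nlinarith
  have h3 := (h2.comp hu).mul_const K
  rw [zero_mul] at h3
  refine h3.congr fun r => ?_
  simp only [Function.comp]
  rw [Real.sq_sqrt (Nat.cast_nonneg r)]
  ring

lemma aux_pt (r₁ : ℕ) (Ω s : ℝ) :
    Filter.Tendsto (fun r : ℕ =>
      Complex.exp (-(((s / Real.sqrt r : ℝ) : ℂ) * Complex.I) *
        ((r : ℂ) * Complex.exp (Complex.I * (Ω / Real.sqrt r)))) *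
      (1 - ((s / Real.sqrt r : ℝ) : ℂ) * Complex.I) ^ (-((r : ℤ) + r₁)))
      Filter.atTop (nhds (Complex.exp ((-s^2/2 + s * Ω : ℝ) : ℂ))) := by
  have hu : Filter.Tendsto (fun r : ℕ => Real.sqrt r) Filter.atTop Filter.atTop :=
    Real.tendsto_sqrt_atTop.comp tendsto_natCast_atTop_atTop
  have hh : Filter.Tendsto (fun r : ℕ => (Real.sqrt r)⁻¹) Filter.atTop (nhdsWithin 0 {0}ᶜ) := by
    refine tendsto_nhdsWithin_iff.2 ⟨tendsto_inv_atTop_zero.comp hu, ?_⟩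
    filter_upwards [Filter.eventually_gt_atTop 0] with r hr
    have : 0 < Real.sqrt r := Real.sqrt_pos.2 (by exact_mod_cast hr)
    simp [hr.ne']
  -- first part
  have A : Filter.Tendsto (fun h : ℝ => -(s * Complex.I) * ((h:ℂ)⁻¹ * (Complex.exp (Complex.I * (Ω * h)) - 1)))
      (nhdsWithin 0 {0}ᶜ) (nhds (s * Ω)) := by
    have h1 : HasDerivAt (fun h : ℝ => Complex.exp (Complex.I * (Ω * h)))
        (Complex.exp (Complex.I * (Ω * (0:ℝ))) * (Complex.I * (Ω * 1))) 0 := by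
      refine HasDerivAt.cexp (HasDerivAt.const_mul _ (HasDerivAt.const_mul _ ?_))
      exact Complex.ofRealCLM.hasDerivAt (x := (0:ℝ))
    have h2 := (hasDerivAt_iff_tendsto_slope_zero.1 h1).const_mul (-(s * Complex.I))
    convert h2 using 2
    · simp
    · simp; linear_combination ((s:ℂ) * Ω) * Complex.I_sq
  have B : Filter.Tendsto (fun h : ℝ => ((h:ℂ)^2)⁻¹ * (- (s * Complex.I * h) - Complex.log (1 - s * h * Complex.I)))
      (nhdsWithin 0 {0}ᶜ) (nhds (-s^2/2)) := by
    rw [tendsto_iff_norm_sub_tendsto_zero]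
    have hz : Filter.Tendsto (fun h : ℝ => ‖-(s * h * Complex.I : ℂ)‖) (nhdsWithin 0 {0}ᶜ) (nhds 0) := by
      have : Continuous (fun h : ℝ => ‖-(s * h * Complex.I : ℂ)‖) := by fun_prop
      have := (this.tendsto 0).mono_left (nhdsWithin_le_nhds (s := {0}ᶜ))
      simpa using this
    have hb : Filter.Tendsto (fun h : ℝ => |h| * (|s|^3 * (1 - ‖-(s * h * Complex.I : ℂ)‖)⁻¹ / 3)) (nhdsWithin 0 {0}ᶜ) (nhds 0) := by
      have h1 : Filter.Tendsto (fun h : ℝ => |h|) (nhdsWithin 0 {0}ᶜ) (nhds 0) := by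
        have := (continuous_abs.tendsto (0:ℝ)).mono_left (nhdsWithin_le_nhds (s := {0}ᶜ))
        simpa using this
      have h2 : Filter.Tendsto (fun h : ℝ => (1 - ‖-(s * h * Complex.I : ℂ)‖)⁻¹) (nhdsWithin 0 {0}ᶜ) (nhds 1) := by
        have := (hz.const_sub 1).inv₀ (by norm_num)
        simpa using this
      have := h1.mul ((h2.const_mul (|s|^3)).div_const 3)
      rwa [zero_mul] at this
    refine squeeze_zero' (Filter.Eventually.of_forall fun _ => norm_nonneg _) ?_ hb
    filter_upwards [hz.eventually_lt_const zero_lt_one, self_mem_nhdsWithin] with h hh1 hh0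
    have hh0 : h ≠ 0 := hh0
    have h0c : (h:ℂ) ≠ 0 := by exact_mod_cast hh0
    have key := Complex.norm_log_sub_logTaylor_le 2 hh1
    have e : Complex.logTaylor (2+1) (-(s * h * Complex.I : ℂ)) = -(s * h * Complex.I) + s^2*h^2/2 := by
      simp [Complex.logTaylor_succ, Complex.logTaylor_zero]
      linear_combination (-((s:ℂ)^2 * h^2)) * Complex.I_sq
    rw [e] at key
    have e2 : ((h:ℂ)^2)⁻¹ * (- (s * Complex.I * h) - Complex.log (1 - s * h * Complex.I)) - (-s^2/2)
      = -(((h:ℂ)^2)⁻¹ * (Complex.log (1 + -(s * h * Complex.I)) - (-(s * h * Complex.I) + s^2*h^2/2))) := by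
      rw [← sub_eq_add_neg]
      field_simp
      ring
    rw [e2, norm_neg, norm_mul]
    refine (mul_le_mul_of_nonneg_left key (norm_nonneg _)).trans (le_of_eq ?_)
    have e3 : ‖-(s * h * Complex.I : ℂ)‖ = |s| * |h| := by simp
    have e4 : ‖((h:ℂ)^2)⁻¹‖ = (|h|^2)⁻¹ := by simp
    rw [e3, e4]
    have : |h| ≠ 0 := by simpa using hh0
    generalize (1 - |s| * |h|)⁻¹ = w
    push_cast
    field_simp
    norm_num
  have C : Filter.Tendsto (fun h : ℝ => (1 - s * h * Complex.I) ^ (-(r₁:ℤ)))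
      (nhdsWithin 0 {0}ᶜ) (nhds 1) := by
    have h1 : ContinuousAt (fun h : ℝ => (1 - s * h * Complex.I) ^ (-(r₁:ℤ))) 0 := by
      refine ContinuousAt.zpow₀ (by fun_prop) _ (Or.inl (by simp))
    have := h1.tendsto.mono_left (nhdsWithin_le_nhds (s := {0}ᶜ))
    simpa using this
  have D := (((Complex.continuous_exp.tendsto _).comp (A.add B)).mul C).comp hh
  have e : (s:ℂ) * Ω + -s^2/2 = ((-s^2/2 + s * Ω : ℝ) : ℂ) := by push_cast; ring
  rw [mul_one, e] at D
  refine D.congr' ?_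
  filter_upwards [Filter.eventually_gt_atTop 0] with r hr
  have hpos : 0 < Real.sqrt r := Real.sqrt_pos.2 (by exact_mod_cast hr)
  have hc : ((Real.sqrt r : ℝ) : ℂ) ≠ 0 := by exact_mod_cast hpos.ne'
  have hsq : ((Real.sqrt r : ℝ) : ℂ)^2 = r := by
    rw [← Complex.ofReal_pow, Real.sq_sqrt (Nat.cast_nonneg r)]; simp
  have hne : 1 - s * ((Real.sqrt r)⁻¹ : ℝ) * Complex.I ≠ 0 := by
    intro h
    have := congrArg Complex.re h
    simp at this
  simp only [Function.comp]
  have e5 : ((s / Real.sqrt r : ℝ) : ℂ) = s * ((Real.sqrt r)⁻¹ : ℝ) := by push_cast; rfl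
  rw [e5, neg_add, zpow_add₀ hne, ← mul_assoc (Complex.exp (-(s * ((Real.sqrt r)⁻¹ : ℝ) * Complex.I) * _))]
  congr 1
  have e6 : (1 - s * ((Real.sqrt r)⁻¹ : ℝ) * Complex.I) ^ (-(r:ℤ)) =
      Complex.exp (-(r * Complex.log (1 - s * ((Real.sqrt r)⁻¹ : ℝ) * Complex.I))) := by
    rw [Complex.exp_neg, Complex.exp_nat_mul, Complex.exp_log hne, zpow_neg, zpow_natCast]
  rw [e6, ← Complex.exp_add]
  congr 1
  rw [← hsq]
  push_cast
  field_simp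
  ring

lemma aux_int (b c : ℝ) (hb : 0 < b) : Integrable (fun s : ℝ => Real.exp (-b * s^2 + c * s)) := by
  have := (integrable_cexp_quadratic' (b := ((-b : ℝ) : ℂ)) (by simpa using hb) (c:ℂ) 0).re
  refine this.congr (Filter.Eventually.of_forall fun s => ?_)
  have : ((-b : ℝ) : ℂ) * (s:ℂ)^2 + c * s + 0 = ((-b * s^2 + c * s : ℝ) : ℂ) := by push_cast; ring
  simp only [this, ← Complex.ofReal_exp]
  exact Complex.ofReal_re _

lemma aux_J (Ω : ℝ) : Real.exp (-Ω^2/2) * ((∫ s in Set.Ioi (0:ℝ), Real.exp (-s^2/2 + s * Ω)) -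
    ∫ s in Set.Ioi (0:ℝ), Real.exp (-s^2/2 + s * (-Ω))) = 2 * ∫ u in (0:ℝ)..Ω, Real.exp (-u^2/2) := by
  have hi : Integrable (fun u : ℝ => Real.exp (-u^2/2)) := by
    convert aux_int (1/2) 0 (by norm_num) using 3; ring
  have sh : ∀ w : ℝ, Real.exp (-w^2/2) * (∫ s in Set.Ioi (0:ℝ), Real.exp (-s^2/2 + s * w)) =
      ∫ u in Set.Ioi (-w), Real.exp (-u^2/2) := by
    intro w
    rw [← integral_const_mul]
    have := (measurePreserving_add_right volume (-w)).setIntegral_preimage_emb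
      (measurableEmbedding_addRight _) (fun u => Real.exp (-u^2/2)) (Set.Ioi (-w))
    rw [Set.preimage_add_const_Ioi, sub_self] at this
    rw [← this]
    congr 1
    ext s
    rw [← Real.exp_add]
    congr 1
    ring
  have h2 := sh (-Ω)
  rw [neg_neg, neg_sq] at h2
  rw [mul_sub, sh Ω, h2]
  have h3 := intervalIntegral.integral_Ioi_sub_Ioi' (a := -Ω) (b := Ω) hi.integrableOn hi.integrableOn
  rw [h3]
  have hii : ∀ a b : ℝ, IntervalIntegrable (fun u : ℝ => Real.exp (-u^2/2)) volume a b :=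
    fun a b => hi.intervalIntegrable
  rw [← intervalIntegral.integral_add_adjacent_intervals (hii (-Ω) 0) (hii 0 Ω)]
  have := intervalIntegral.integral_comp_neg (a := 0) (b := Ω) (fun u => Real.exp (-u^2/2))
  simp only [neg_sq, neg_zero] at this
  rw [← this]; ring

lemma aux_vert (M : ℝ) (hM : 2 < M) (r₁ : ℕ) (Ω : ℝ) :
    Filter.Tendsto (fun r : ℕ => (Real.sqrt r : ℂ) * ∫ t in (0:ℝ)..M,
      Complex.exp (-((t : ℂ) * Complex.I) *
        ((r : ℂ) * Complex.exp (Complex.I * (Ω / Real.sqrt r)))) *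
      (1 - (t : ℂ) * Complex.I) ^ (-((r : ℤ) + r₁)) * Complex.I)
      Filter.atTop (nhds (Complex.I * ((∫ s in Set.Ioi (0:ℝ), Real.exp (-s^2/2 + s * Ω) : ℝ) : ℂ))) := by
  set V : ℕ → ℝ → ℂ := fun r s => Complex.exp (-(((s / Real.sqrt r : ℝ) : ℂ) * Complex.I) *
        ((r : ℂ) * Complex.exp (Complex.I * (Ω / Real.sqrt r)))) *
      (1 - ((s / Real.sqrt r : ℝ) : ℂ) * Complex.I) ^ (-((r : ℤ) + r₁)) with hV
  have hne : ∀ t : ℝ, 1 - (t:ℂ) * Complex.I ≠ 0 := by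
    intro t h
    have := congrArg Complex.re h
    simp at this
  have hVc : ∀ r, Continuous (V r) := by
    intro r
    refine Continuous.mul (by fun_prop) ?_
    exact Continuous.zpow₀ (by fun_prop) _ (fun s => Or.inl (hne _))
  set c : ℝ := 1 / (1 + M^2) with hc
  have hcpos : 0 < c := by positivity
  have lim : Filter.Tendsto (fun r : ℕ => ∫ s in Set.Ioi (0:ℝ),
      (Set.Ioc 0 (M * Real.sqrt r)).indicator (V r) s) Filter.atTop
      (nhds (∫ s in Set.Ioi (0:ℝ), Complex.exp ((-s^2/2 + s * Ω : ℝ) : ℂ))) := by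
    apply tendsto_integral_of_dominated_convergence (fun s => Real.exp (-(c/2) * s^2 + |Ω| * s))
    · intro r
      exact ((hVc r).aestronglyMeasurable).indicator measurableSet_Ioc
    · exact (aux_int (c/2) |Ω| (by positivity)).integrableOn
    · intro r
      filter_upwards with s
      by_cases hs : s ∈ Set.Ioc 0 (M * Real.sqrt r)
      swap
      · rw [Set.indicator_of_notMem hs, norm_zero]; positivity
      rw [Set.indicator_of_mem hs]
      have hpos : 0 < Real.sqrt r := by
        by_contra h
        have : M * Real.sqrt r ≤ 0 := mul_nonpos_of_nonneg_of_nonpos (by linarith) (not_lt.1 h)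
        linarith [hs.1, hs.2]
      have hrsq : Real.sqrt r ^ 2 = r := Real.sq_sqrt (Nat.cast_nonneg r)
      have hr0 : (0:ℝ) < r := Real.sqrt_pos.1 hpos
      simp only [hV]
      rw [norm_mul, add_comm (-(c/2) * s^2), Real.exp_add]
      refine mul_le_mul ?_ ?_ (norm_nonneg _) (Real.exp_pos _).le
      · refine (aux_x Ω r _ (by simp)).trans (le_of_eq ?_)
        rw [norm_mul, Complex.norm_I, Complex.norm_real, Real.norm_of_nonneg (div_nonneg hs.1.le hpos.le)]
        congr 1
        field_simp
      · set u := (s / Real.sqrt r)^2 with hu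
        have hu1 : u ≤ M^2 := by
          apply pow_le_pow_left₀ (div_nonneg hs.1.le hpos.le)
          rw [div_le_iff₀ hpos]; exact hs.2
        have hu0 : 0 ≤ u := sq_nonneg _
        have hn : ‖1 - ((s / Real.sqrt r : ℝ) : ℂ) * Complex.I‖^2 = 1 + u := by
          rw [← Complex.normSq_eq_norm_sq, Complex.normSq_apply]
          simp [hu]
          ring
        have hge : Real.exp (c * u) ≤ 1 + u := by
          rw [← Real.le_log_iff_exp_le (by positivity)]
          have h1 := Real.one_sub_inv_le_log_of_pos (x := 1 + u) (by positivity)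
          refine le_trans ?_ h1
          have : 1 - (1+u)⁻¹ = 1/(1+u) * u := by field_simp; ring
          rw [this, hc]
          apply mul_le_mul_of_nonneg_right _ hu0
          apply one_div_le_one_div_of_le (by positivity)
          linarith
        have hge2 : Real.exp (c / 2 * u) ≤ ‖1 - ((s / Real.sqrt r : ℝ) : ℂ) * Complex.I‖ := by
          apply le_of_sq_le_sq _ (norm_nonneg _)
          have e9 : ((2:ℕ):ℝ) * (c / 2 * u) = c * u := by push_cast; ring
          rw [hn, ← Real.exp_nat_mul, e9]
          exact hge
        have hk : ((r:ℤ) + r₁) = ((r + r₁ : ℕ) : ℤ) := by push_cast; rfl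
        have h1 : 1 ≤ ‖1 - ((s / Real.sqrt r : ℝ) : ℂ) * Complex.I‖ :=
          (Real.one_le_exp (by positivity)).trans hge2
        rw [norm_zpow, zpow_neg, hk, zpow_natCast, neg_mul, Real.exp_neg]
        apply inv_anti₀ (Real.exp_pos _)
        calc Real.exp (c/2 * s^2) = Real.exp (c / 2 * u)^r := by
              rw [← Real.exp_nat_mul, hu, div_pow, hrsq]
              congr 1
              field_simp
          _ ≤ ‖1 - ((s / Real.sqrt r : ℝ) : ℂ) * Complex.I‖^r := pow_le_pow_left₀ (Real.exp_pos _).le hge2 _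
          _ ≤ _ := pow_le_pow_right₀ h1 (by omega)
    · filter_upwards [ae_restrict_mem measurableSet_Ioi] with s hs
      refine (aux_pt r₁ Ω s).congr' ?_
      have hu : Filter.Tendsto (fun r : ℕ => M * Real.sqrt r) Filter.atTop Filter.atTop :=
        (Real.tendsto_sqrt_atTop.comp tendsto_natCast_atTop_atTop).const_mul_atTop (by linarith)
      filter_upwards [hu.eventually_ge_atTop s] with r hr
      have hm : s ∈ Set.Ioc 0 (M * Real.sqrt r) := ⟨hs, hr⟩
      rw [Set.indicator_of_mem hm]
  have lim2 := lim.const_mul Complex.I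
  have e : (∫ s in Set.Ioi (0:ℝ), Complex.exp ((-s^2/2 + s * Ω : ℝ) : ℂ)) =
      ((∫ s in Set.Ioi (0:ℝ), Real.exp (-s^2/2 + s * Ω) : ℝ) : ℂ) := by
    rw [← integral_complex_ofReal]
    simp only [Complex.ofReal_exp]
  rw [e] at lim2
  refine lim2.congr' ?_
  filter_upwards [Filter.eventually_gt_atTop 0] with r hr
  have hpos : 0 < Real.sqrt r := Real.sqrt_pos.2 (by exact_mod_cast hr)
  have hsub := intervalIntegral.integral_comp_div (a := 0) (b := M * Real.sqrt r)
    (fun t : ℝ => Complex.exp (-((t : ℂ) * Complex.I) *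
        ((r : ℂ) * Complex.exp (Complex.I * (Ω / Real.sqrt r)))) *
      (1 - (t : ℂ) * Complex.I) ^ (-((r : ℤ) + r₁))) hpos.ne'
  rw [zero_div, mul_div_cancel_right₀ _ hpos.ne', Complex.real_smul] at hsub
  rw [intervalIntegral.integral_mul_const, ← mul_assoc, ← hsub, mul_comm Complex.I]
  congr 1
  rw [intervalIntegral.integral_of_le (by positivity), setIntegral_indicator measurableSet_Ioc,
    Set.inter_eq_self_of_subset_right Set.Ioc_subset_Ioi_self]

lemma aux_upper (δ M : ℝ) (hδ : δ ∈ Set.Ioo 0 (π / 2)) (hM : 2 < M) (r₁ : ℕ) (Ω : ℝ) :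
    Filter.Tendsto (fun r : ℕ => (Real.sqrt r : ℂ) * ∫ t in (0:ℝ)..M,
      Complex.exp (-((t : ℂ) * Complex.exp (Complex.I * δ)) *
        ((r : ℂ) * Complex.exp (Complex.I * (Ω / Real.sqrt r)))) *
      (1 - (t : ℂ) * Complex.exp (Complex.I * δ)) ^ (-((r : ℤ) + r₁)) * Complex.exp (Complex.I * δ))
      Filter.atTop (nhds (Complex.I * ((∫ s in Set.Ioi (0:ℝ), Real.exp (-s^2/2 + s * Ω) : ℝ) : ℂ))) := by
  have hv := aux_vert M hM r₁ Ω
  have hd := aux_decay (M * |Ω|) (Real.log (M-1)) (M * (π/2 - δ)) (Real.log_pos (by linarith))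
  refine tendsto_of_tendsto_of_dist hv ?_
  refine squeeze_zero (fun _ => dist_nonneg) (fun r => ?_) hd
  rw [dist_comm, dist_eq_norm, ← mul_sub, norm_mul, Complex.norm_real, Real.norm_of_nonneg (Real.sqrt_nonneg _)]
  apply mul_le_mul_of_nonneg_left _ (Real.sqrt_nonneg _)
  rw [← mul_assoc]
  refine aux_contour δ M hδ hM (fun p => Complex.exp (-p *
        ((r : ℂ) * Complex.exp (Complex.I * (Ω / Real.sqrt r)))) *
      (1 - p) ^ (-((r : ℤ) + r₁))) ?_ _ ?_
  · intro z hz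
    refine DifferentiableAt.mul (by fun_prop) ?_
    exact DifferentiableAt.zpow (by fun_prop) (Or.inl (sub_ne_zero.2 hz.symm))
  · intro φ hφ
    apply aux_arc M hM
    · rw [mul_comm Complex.I, Complex.re_ofReal_mul, Complex.exp_ofReal_mul_I_re]
      exact mul_nonneg (by linarith) (Real.cos_nonneg_of_mem_Icc ⟨by linarith [hδ.1, hφ.1, Real.pi_pos], hφ.2⟩)
    · rw [norm_mul, mul_comm Complex.I, Complex.norm_exp_ofReal_mul_I, Complex.norm_real, Real.norm_of_nonneg (by linarith), mul_one]

theorem stmt_10 (δ M : ℝ) (hδ : δ ∈ Set.Ioo 0 (π / 2)) (hM : 2 < M)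
    (r₁ : ℕ) (hr₁ : 1 ≤ r₁) (Ω : ℝ)
    (x : ℕ → ℂ) (hx : ∀ r : ℕ, x r = (r : ℂ) *
      Complex.exp (Complex.I * (Ω / Real.sqrt r)))
    (g : ℕ → ℂ)
    (hg : ∀ r : ℕ, g r =
      (1 / 2 : ℂ) * (∫ t in (0 : ℝ)..M,
        Complex.exp (-((t : ℂ) * Complex.exp (Complex.I * δ)) * x r) *
          (1 - (t : ℂ) * Complex.exp (Complex.I * δ)) ^ (-((r : ℤ) + r₁)) *
          Complex.exp (Complex.I * δ)) +
      (1 / 2 : ℂ) * ∫ t in (0 : ℝ)..M,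
        Complex.exp (-((t : ℂ) * Complex.exp (-Complex.I * δ)) * x r) *
          (1 - (t : ℂ) * Complex.exp (-Complex.I * δ)) ^ (-((r : ℤ) + r₁)) *
          Complex.exp (-Complex.I * δ)) :
    Filter.Tendsto
      (fun r : ℕ => (Real.sqrt r : ℂ) * Real.exp (-Ω ^ 2 / 2) * g r)
      Filter.atTop
      (nhds (Complex.I * (Real.sqrt (π / 2) : ℂ) *
        (erf (Ω / Real.sqrt 2) : ℂ))) := by
  have h1 := aux_upper δ M hδ hM r₁ Ω
  have h2 := (Complex.continuous_conj.tendsto _).comp (aux_upper δ M hδ hM r₁ (-Ω))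
  have h3 := ((h1.add h2).const_mul ((1/2 : ℂ) * Real.exp (-Ω ^ 2 / 2)))
  have hJ := aux_J Ω
  set J₁ := ∫ s in Set.Ioi (0:ℝ), Real.exp (-s^2/2 + s * Ω)
  set J₂ := ∫ s in Set.Ioi (0:ℝ), Real.exp (-s^2/2 + s * (-Ω))
  have hs2 : Real.sqrt 2 ≠ 0 := by positivity
  have hE : Real.exp (-Ω^2/2) * (J₁ - J₂) = 2 * (Real.sqrt (π/2) * erf (Ω / Real.sqrt 2)) := by
    rw [hJ, erf]
    have hsub := intervalIntegral.integral_comp_div (a := 0) (b := Ω)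
      (fun t : ℝ => Real.exp (-t^2)) hs2
    rw [zero_div, smul_eq_mul] at hsub
    have : ∀ u : ℝ, Real.exp (-(u / Real.sqrt 2)^2) = Real.exp (-u^2/2) := by
      intro u
      rw [div_pow, Real.sq_sqrt (by norm_num), neg_div]
    simp only [this] at hsub
    rw [hsub, Real.sqrt_div Real.pi_pos.le]
    have hp : Real.sqrt π ≠ 0 := (Real.sqrt_pos.2 Real.pi_pos).ne'
    have h22 : Real.sqrt 2 ^ 2 = 2 := Real.sq_sqrt (by norm_num)
    field_simp
    rw [h22]
  have hlim : (1/2 : ℂ) * Real.exp (-Ω ^ 2 / 2) * (Complex.I * (J₁:ℂ) + (starRingEnd ℂ) (Complex.I * (J₂:ℂ)))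
      = Complex.I * (Real.sqrt (π / 2) : ℂ) * (erf (Ω / Real.sqrt 2) : ℂ) := by
    have hE' := congrArg (fun y : ℝ => (y:ℂ)) hE
    simp only [Complex.ofReal_mul, Complex.ofReal_sub] at hE'
    rw [map_mul, Complex.conj_I, Complex.conj_ofReal]
    push_cast at hE' ⊢
    linear_combination (Complex.I / 2) * hE'
  rw [hlim] at h3
  refine h3.congr fun r => ?_
  simp only [Function.comp]
  rw [hg, map_mul, Complex.conj_ofReal, ← intervalIntegral.intervalIntegral_conj]
  have hconj : ∀ t : ℝ, (starRingEnd ℂ) (Complex.exp (-((t : ℂ) * Complex.exp (Complex.I * δ)) *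
        ((r : ℂ) * Complex.exp (Complex.I * ((-Ω : ℝ) / Real.sqrt r)))) *
      (1 - (t : ℂ) * Complex.exp (Complex.I * δ)) ^ (-((r : ℤ) + r₁)) * Complex.exp (Complex.I * δ)) =
      Complex.exp (-((t : ℂ) * Complex.exp (-Complex.I * δ)) * x r) *
          (1 - (t : ℂ) * Complex.exp (-Complex.I * δ)) ^ (-((r : ℤ) + r₁)) *
          Complex.exp (-Complex.I * δ) := by
    intro t
    rw [hx]
    simp only [map_mul, map_zpow₀, map_sub, map_one, ← Complex.exp_conj, map_neg, map_div₀,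
      Complex.conj_I, Complex.conj_ofReal, map_natCast, Complex.ofReal_neg, neg_div, neg_mul_neg]
  simp only [hconj, hx]
  ring
end

section
/- Let δ ∈ (0, π/2) and for x > 0 define F_±(x) = ∫_0^{∞e^{±iδ}} e^{−xp}/(1−p) dp. Then: (i) both integrals converge absolutely and F_± are differentiable on (0, ∞) with F_±′(x) + F_±(x) = 1/x for all x > 0; and (ii) F_+(x) − F_−(x) = 2πi·e^{−x} for all x > 0. -/
open MeasureTheory Real

/-- The lateral Borel sum of `∑ k! x^{-k-1}` along the ray `arg p = θ`:
`F_θ(x) = ∫_0^{∞e^{iθ}} e^{-xp}/(1-p) dp`. -/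
noncomputable def lateralBorelSum (θ : ℝ) (x : ℝ) : ℂ :=
  ∫ t in Set.Ioi (0 : ℝ),
    Complex.exp (-(x : ℂ) * ((t : ℂ) * Complex.exp (Complex.I * θ))) /
      (1 - (t : ℂ) * Complex.exp (Complex.I * θ)) *
      Complex.exp (Complex.I * θ)

noncomputable def auxG (w : ℂ) (x t : ℝ) : ℂ :=
  Complex.exp (-(x : ℂ) * ((t : ℂ) * w)) / (1 - (t : ℂ) * w) * w

lemma aux_low (w : ℂ) (hn : ‖w‖ = 1) (t : ℝ) : |w.im| ≤ ‖1 - (t : ℂ) * w‖ := by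
  have h1 : (starRingEnd ℂ w) * (1 - (t : ℂ) * w) = starRingEnd ℂ w - t := by
    have : (starRingEnd ℂ w) * w = 1 := by
      rw [mul_comm, Complex.mul_conj, Complex.normSq_eq_norm_sq, hn]; simp
    linear_combination (-(t : ℂ)) * this
  have h2 : ‖1 - (t : ℂ) * w‖ = ‖starRingEnd ℂ w - t‖ := by
    rw [← h1, norm_mul, RCLike.norm_conj, hn, one_mul]
  rw [h2]
  have := Complex.abs_im_le_norm (starRingEnd ℂ w - t)
  simpa using this

lemma aux_ne (w : ℂ) (him : w.im ≠ 0) (t : ℝ) : 1 - (t : ℂ) * w ≠ 0 := by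
  intro h
  have h1 := congrArg Complex.im h
  have h2 := congrArg Complex.re h
  simp [him] at h1 h2
  simp [h1] at h2

lemma aux_cont (w : ℂ) (him : w.im ≠ 0) (x : ℝ) : Continuous (auxG w x) := by
  unfold auxG
  have := aux_ne w him
  fun_prop (disch := assumption)

lemma aux_nexp (w : ℂ) (x t : ℝ) :
    ‖Complex.exp (-(x : ℂ) * ((t : ℂ) * w))‖ = Real.exp (-(x * w.re) * t) := by
  rw [Complex.norm_exp]
  congr 1
  simp
  ring

lemma aux_bound (w : ℂ) (hn : ‖w‖ = 1) (him : w.im ≠ 0) (x t : ℝ) :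
    ‖auxG w x t‖ ≤ |w.im|⁻¹ * Real.exp (-(x * w.re) * t) := by
  unfold auxG
  rw [norm_mul, norm_div, hn, mul_one, aux_nexp, div_eq_inv_mul]
  gcongr
  exact aux_low w hn t

lemma aux_int_s13 (w : ℂ) (hn : ‖w‖ = 1) (hre : 0 < w.re) (him : w.im ≠ 0) (x : ℝ) (hx : 0 < x) :
    IntegrableOn (auxG w x) (Set.Ioi 0) := by
  refine Integrable.mono' (g := fun t => |w.im|⁻¹ * Real.exp (-(x * w.re) * t)) ?_
    (aux_cont w him x).aestronglyMeasurable (Filter.Eventually.of_forall (aux_bound w hn him x))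
  exact (exp_neg_integrableOn_Ioi 0 (mul_pos hx hre)).const_mul _

lemma aux_deriv (w : ℂ) (hn : ‖w‖ = 1) (hre : 0 < w.re) (him : w.im ≠ 0) (x : ℝ) (hx : 0 < x) :
    HasDerivAt (fun x => ∫ t in Set.Ioi (0:ℝ), auxG w x t)
      (1 / (x : ℂ) - ∫ t in Set.Ioi (0:ℝ), auxG w x t) x := by
  have hwx : (-(x:ℂ) * w).re < 0 := by simp; positivity
  have hw0 : w ≠ 0 := by rintro rfl; simp at hre
  have hxc : (x : ℂ) ≠ 0 := by exact_mod_cast hx.ne'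
  have hE : IntegrableOn (fun t : ℝ => Complex.exp (-(x : ℂ) * ((t : ℂ) * w)) * w)
      (Set.Ioi 0) := by
    refine Integrable.mul_const ?_ _
    refine (integrableOn_exp_mul_complex_Ioi hwx 0).congr_fun (fun t _ => ?_) measurableSet_Ioi
    ring_nf
  have hEv : ∫ t in Set.Ioi (0:ℝ), Complex.exp (-(x : ℂ) * ((t : ℂ) * w)) * w = 1 / (x:ℂ) := by
    rw [integral_mul_const]
    have := integral_exp_mul_complex_Ioi hwx 0
    have h2 : ∀ t : ℝ, Complex.exp (-(x : ℂ) * ((t : ℂ) * w)) = Complex.exp (-(x:ℂ) * w * t) := by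
      intro t; ring_nf
    simp_rw [h2]
    rw [this]
    simp
    field_simp
  have key := hasDerivAt_integral_of_dominated_loc_of_deriv_le (μ := volume.restrict (Set.Ioi (0:ℝ)))
    (F := fun x t => auxG w x t)
    (F' := fun x t => Complex.exp (-(x : ℂ) * ((t : ℂ) * w)) * w - auxG w x t)
    (x₀ := x) (s := Set.Ioi (x / 2))
    (bound := fun t => (1 + |w.im|⁻¹) * Real.exp (-(x / 2 * w.re) * t))
    (Ioi_mem_nhds (by linarith))
    (Filter.Eventually.of_forall fun y => (aux_cont w him y).aestronglyMeasurable)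
    (aux_int_s13 w hn hre him x hx)
    (by
      apply Continuous.aestronglyMeasurable
      have := aux_cont w him x
      fun_prop)
    (by
      filter_upwards [ae_restrict_mem measurableSet_Ioi] with t ht y hy
      have ht : 0 < t := ht
      have hy : x / 2 < y := hy
      refine (norm_sub_le _ _).trans ?_
      rw [norm_mul, hn, mul_one, aux_nexp, add_mul, one_mul]
      have h3 : Real.exp (-(y * w.re) * t) ≤ Real.exp (-(x / 2 * w.re) * t) := by
        apply Real.exp_le_exp.2
        have : x / 2 * w.re * t ≤ y * w.re * t := by gcongr
        linarith
      refine add_le_add h3 ((aux_bound w hn him y t).trans ?_)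
      gcongr)
    ((exp_neg_integrableOn_Ioi 0 (by positivity)).const_mul _)
    (by
      refine Filter.Eventually.of_forall fun t y _ => ?_
      have hne := aux_ne w him t
      have h1 : HasDerivAt (fun z : ℂ => Complex.exp (-z * ((t : ℂ) * w)) / (1 - (t : ℂ) * w) * w)
          (Complex.exp (-(y:ℂ) * ((t : ℂ) * w)) * (-1 * ((t:ℂ) * w)) / (1 - (t : ℂ) * w) * w) (y:ℂ) :=
        ((((hasDerivAt_id (y:ℂ)).neg.mul_const _).cexp).div_const _).mul_const _
      have h2 := h1.comp_ofReal
      refine HasDerivAt.congr_deriv h2 ?_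
      unfold auxG
      field_simp
      ring)
  have h := key.2
  rw [integral_sub hE (aux_int_s13 w hn hre him x hx), hEv] at h
  exact h

lemma aux_log_pos (z : ℂ) (h : 0 < z.im) : Complex.log (-z) = Complex.log z - π * Complex.I := by
  unfold Complex.log
  rw [Complex.arg_neg_eq_arg_sub_pi_of_im_pos h, norm_neg]
  push_cast; ring

lemma aux_log_neg (z : ℂ) (h : z.im < 0) : Complex.log (-z) = Complex.log z + π * Complex.I := by
  unfold Complex.log
  rw [Complex.arg_neg_eq_arg_add_pi_of_im_neg h, norm_neg]
  push_cast; ring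

lemma aux_prim (x R : ℝ) : ∃ Q : ℂ → ℂ, ∀ z ∈ Metric.ball (0:ℂ) R, z ≠ 1 →
    HasDerivAt Q ((Complex.exp (-(x:ℂ) * z) - Complex.exp (-(x:ℂ))) / (1 - z)) z := by
  let f : ℂ → ℂ := fun z => -Complex.exp (-(x:ℂ) * z)
  have hf : Differentiable ℂ f := by fun_prop
  have hd : DifferentiableOn ℂ (dslope f 1) Set.univ :=
    (Complex.differentiableOn_dslope Filter.univ_mem).2 hf.differentiableOn
  obtain ⟨Q, hQ⟩ := (hd.mono (Set.subset_univ (Metric.ball (0:ℂ) R))).isExactOn_ball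
  refine ⟨Q, fun z hz h1 => ?_⟩
  have := hQ z hz
  rw [dslope_of_ne _ h1, slope_def_field] at this
  refine HasDerivAt.congr_deriv this ?_
  have a : 1 - z ≠ 0 := sub_ne_zero.2 h1.symm
  have b : z - 1 ≠ 0 := sub_ne_zero.2 h1
  simp only [f, mul_one]
  rw [div_eq_div_iff b a]
  ring

/-- FTC on a ray -/
lemma aux_ftc (w : ℂ) (hn : ‖w‖ = 1) (him : w.im ≠ 0) (x R : ℝ) (hR : 0 < R)
    (Q : ℂ → ℂ) (hQ : ∀ z ∈ Metric.ball (0:ℂ) (R + 1), z ≠ 1 →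
    HasDerivAt Q ((Complex.exp (-(x:ℂ) * z) - Complex.exp (-(x:ℂ))) / (1 - z)) z) :
    ∫ t in (0:ℝ)..R, auxG w x t =
      (Q (R * w) - Complex.exp (-(x:ℂ)) * Complex.log (1 - R * w)) - Q 0 := by
  have := intervalIntegral.integral_eq_sub_of_hasDerivAt (a := 0) (b := R)
    (f := fun t : ℝ => Q (t * w) - Complex.exp (-(x:ℂ)) * Complex.log (1 - t * w))
    (f' := auxG w x) ?_ ((aux_cont w him x).intervalIntegrable _ _)
  · rw [this]; simp
  · intro t ht
    rw [Set.uIcc_of_le hR.le] at ht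
    have hne := aux_ne w him t
    have hmem : (t:ℂ) * w ∈ Metric.ball (0:ℂ) (R + 1) := by
      simp [hn, abs_of_nonneg ht.1]; linarith [ht.2]
    have hslit : 1 - (t:ℂ) * w ∈ Complex.slitPlane := by
      rw [Complex.mem_slitPlane_iff]
      by_cases h0 : t = 0
      · left; simp [h0]
      · right; simp [h0, him]
    have hq := hQ _ hmem (fun h => hne (by rw [h]; ring))
    have h1 : HasDerivAt (fun z : ℂ => z * w) w (t:ℂ) := by
      simpa using (hasDerivAt_id (t:ℂ)).mul_const w
    have h2 := (hq.comp (t:ℂ) h1).sub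
      (((h1.const_sub 1).clog hslit).const_mul (Complex.exp (-(x:ℂ))))
    have h3 := h2.comp_ofReal
    refine HasDerivAt.congr_deriv h3 ?_
    unfold auxG
    field_simp
    ring

lemma aux_fin (w : ℂ) (hn : ‖w‖ = 1) (hre : 0 < w.re) (him : 0 < w.im) (x R : ℝ)
    (hR : 0 < R) (hx : 0 < x) (hR2 : 2 ≤ R * w.re) :
    ‖(∫ t in (0:ℝ)..R, auxG w x t) - (∫ t in (0:ℝ)..R, auxG (starRingEnd ℂ w) x t) -
      2 * (π : ℂ) * Complex.I * Complex.exp (-(x:ℂ))‖ ≤ Real.exp (-(x * w.re) * R) * (2 * R) := by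
  obtain ⟨Q, hQ⟩ := aux_prim x (R + 1)
  have hn' : ‖starRingEnd ℂ w‖ = 1 := by rw [RCLike.norm_conj, hn]
  have him' : (starRingEnd ℂ w).im < 0 := by simpa using him
  rw [aux_ftc w hn him.ne' x R hR Q hQ, aux_ftc _ hn' him'.ne x R hR Q hQ]
  set p : ℂ := R * w with hp
  set q : ℂ := R * starRingEnd ℂ w with hq
  have l1 : Complex.log (1 - p) = Complex.log (p - 1) - π * Complex.I := by
    rw [← aux_log_pos]
    · ring_nf
    · simp [hp]; positivity
  have l2 : Complex.log (1 - q) = Complex.log (q - 1) + π * Complex.I := by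
    rw [← aux_log_neg]
    · ring_nf
    · simp [hq]; positivity
  rw [l1, l2]
  let M : ℂ → ℂ := fun z => Q z - Complex.exp (-(x:ℂ)) * Complex.log (z - 1)
  let s : Set ℂ := {z | z.re = R * w.re} ∩ Metric.ball (0:ℂ) (R + 1)
  have hs : Convex ℝ s :=
    (convex_hyperplane (𝕜 := ℝ) (f := fun z : ℂ => z.re) Complex.reLm.isLinear _).inter (convex_ball _ _)
  have hps : p ∈ s := ⟨by simp [hp], by simp [hp, hn, abs_of_pos hR]⟩
  have hqs : q ∈ s := ⟨by simp [hq], by simp [hq, hn, abs_of_pos hR]⟩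
  have hmv := hs.norm_image_sub_le_of_norm_hasDerivWithin_le (f := M)
    (f' := fun z => Complex.exp (-(x:ℂ) * z) / (1 - z)) (C := Real.exp (-(x * w.re) * R))
    (fun z hz => by
      have hzr : z.re = R * w.re := hz.1
      have h1 : z ≠ 1 := by rintro rfl; simp at hzr; linarith
      have hsl : z - 1 ∈ Complex.slitPlane := by
        rw [Complex.mem_slitPlane_iff]; left; simp; linarith
      have a : 1 - z ≠ 0 := sub_ne_zero.2 h1.symm
      have b : z - 1 ≠ 0 := sub_ne_zero.2 h1
      have := (hQ z hz.2 h1).sub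
        ((((hasDerivAt_id z).sub_const 1).clog hsl).const_mul (Complex.exp (-(x:ℂ))))
      refine HasDerivAt.hasDerivWithinAt ?_
      refine HasDerivAt.congr_deriv this ?_
      simp only [id]
      have : z - 1 = -(1 - z) := by ring
      rw [this]
      field_simp
      ring)
    (fun z hz => by
      have hzr : z.re = R * w.re := hz.1
      rw [norm_div, Complex.norm_exp]
      have h1 : 1 ≤ ‖1 - z‖ := by
        refine le_trans ?_ (Complex.abs_re_le_norm _)
        rw [le_abs]; right; simp; linarith
      refine (div_le_self (Real.exp_pos _).le h1).trans (le_of_eq ?_)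
      congr 1
      simp [hzr]; ring) hqs hps
  have hpq : ‖p - q‖ ≤ 2 * R := by
    refine (norm_sub_le _ _).trans ?_
    simp [hp, hq, hn, abs_of_pos hR]; linarith
  calc _ = ‖M p - M q‖ := by
        congr 1; simp only [M]; ring
    _ ≤ _ := hmv.trans (by gcongr)

lemma aux_jump (w : ℂ) (hn : ‖w‖ = 1) (hre : 0 < w.re) (him : 0 < w.im) (x : ℝ) (hx : 0 < x) :
    (∫ t in Set.Ioi (0:ℝ), auxG w x t) - (∫ t in Set.Ioi (0:ℝ), auxG (starRingEnd ℂ w) x t) =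
      2 * (π : ℂ) * Complex.I * Complex.exp (-(x:ℂ)) := by
  have hn' : ‖starRingEnd ℂ w‖ = 1 := by rw [RCLike.norm_conj, hn]
  have i1 := intervalIntegral_tendsto_integral_Ioi 0 (aux_int_s13 w hn hre him.ne' x hx) Filter.tendsto_id
  have i2 := intervalIntegral_tendsto_integral_Ioi 0
    (aux_int_s13 (starRingEnd ℂ w) hn' (by simpa using hre) (by simpa using him.ne') x hx) Filter.tendsto_id
  refine tendsto_nhds_unique (i1.sub i2) ?_
  rw [tendsto_iff_norm_sub_tendsto_zero]
  have hb : Filter.Tendsto (fun R : ℝ => Real.exp (-(x * w.re) * R) * (2 * R)) Filter.atTop (nhds 0) := by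
    have := (tendsto_rpow_mul_exp_neg_mul_atTop_nhds_zero 1 (x * w.re) (by positivity)).const_mul 2
    simp only [mul_zero, Real.rpow_one] at this
    refine this.congr fun R => ?_
    ring_nf
  refine squeeze_zero' (Filter.Eventually.of_forall fun _ => norm_nonneg _) ?_ hb
  filter_upwards [Filter.eventually_gt_atTop 0, Filter.eventually_ge_atTop (2 / w.re)] with R h1 h2
  exact aux_fin w hn hre him x R h1 hx ((div_le_iff₀ hre).1 h2)

/-- The two lateral Borel sums `F_±` of the formal solution of
`y' + y = 1/x`: both converge absolutely, both solve the ODE on `(0,∞)`,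
and their difference (the Stokes jump) is `2πi e^{-x}`. -/
theorem stmt_13 (δ : ℝ) (hδ : δ ∈ Set.Ioo 0 (π / 2)) :
    (∀ x : ℝ, 0 < x →
      IntegrableOn (fun t : ℝ =>
        Complex.exp (-(x : ℂ) * ((t : ℂ) * Complex.exp (Complex.I * δ))) /
          (1 - (t : ℂ) * Complex.exp (Complex.I * δ)) *
          Complex.exp (Complex.I * δ)) (Set.Ioi 0)) ∧
    (∀ x : ℝ, 0 < x →
      IntegrableOn (fun t : ℝ =>
        Complex.exp (-(x : ℂ) * ((t : ℂ) * Complex.exp (Complex.I * (-δ)))) /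
          (1 - (t : ℂ) * Complex.exp (Complex.I * (-δ))) *
          Complex.exp (Complex.I * (-δ))) (Set.Ioi 0)) ∧
    (∀ x : ℝ, 0 < x →
      DifferentiableAt ℝ (lateralBorelSum δ) x ∧
        deriv (lateralBorelSum δ) x + lateralBorelSum δ x = 1 / (x : ℂ)) ∧
    (∀ x : ℝ, 0 < x →
      DifferentiableAt ℝ (lateralBorelSum (-δ)) x ∧
        deriv (lateralBorelSum (-δ)) x + lateralBorelSum (-δ) x = 1 / (x : ℂ)) ∧
    (∀ x : ℝ, 0 < x →
      lateralBorelSum δ x - lateralBorelSum (-δ) x =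
        2 * (π : ℂ) * Complex.I * Complex.exp (-(x : ℂ))) := by
  have hc : 0 < Real.cos δ := Real.cos_pos_of_mem_Ioo ⟨by linarith [hδ.1, Real.pi_pos], hδ.2⟩
  have hs : 0 < Real.sin δ := Real.sin_pos_of_pos_of_lt_pi hδ.1 (by linarith [hδ.2, Real.pi_pos])
  set w : ℂ := Complex.exp (Complex.I * δ) with hw
  have hcw : Complex.exp (Complex.I * (-δ)) = starRingEnd ℂ w := by
    rw [hw, ← Complex.exp_conj]; simp
  have hn : ‖w‖ = 1 := by rw [hw, mul_comm, Complex.norm_exp_ofReal_mul_I]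
  have hre : 0 < w.re := by
    rw [hw, mul_comm, Complex.exp_ofReal_mul_I_re]; exact hc
  have him : 0 < w.im := by
    rw [hw, mul_comm, Complex.exp_ofReal_mul_I_im]; exact hs
  have hn' : ‖starRingEnd ℂ w‖ = 1 := by rw [RCLike.norm_conj, hn]
  have hre' : 0 < (starRingEnd ℂ w).re := by simpa using hre
  have him' : (starRingEnd ℂ w).im ≠ 0 := by simpa using him.ne'
  have e1 : lateralBorelSum δ = fun x => ∫ t in Set.Ioi (0:ℝ), auxG w x t := rfl
  have e2 : lateralBorelSum (-δ) = fun x => ∫ t in Set.Ioi (0:ℝ), auxG (starRingEnd ℂ w) x t := by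
    funext x
    rw [← hcw, ← Complex.ofReal_neg]
    rfl
  rw [e1, e2, hcw]
  refine ⟨aux_int_s13 w hn hre him.ne', aux_int_s13 _ hn' hre' him', fun x hx => ?_, fun x hx => ?_,
    fun x hx => aux_jump w hn hre him x hx⟩
  · have h := aux_deriv w hn hre him.ne' x hx
    exact ⟨h.differentiableAt, by rw [h.deriv]; ring⟩
  · have h := aux_deriv _ hn' hre' him' x hx
    exact ⟨h.differentiableAt, by rw [h.deriv]; ring⟩
end

section
/- Let δ ∈ (0, π/2), let F_±(x) = ∫_0^{∞e^{±iδ}} e^{−xp}/(1−p) dp for x > 0, and set y(x) = (F_+(x) + F_−(x))/2 (the balanced average of the two lateral Borel sums). Then there is a constant C > 0 such that for every real x ≥ 1, | y(x) − ∑_{k=0}^{⌊x⌋} k! x^{−k−1} | ≤ C · x^{−1/2} e^{−x}. -/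
open MeasureTheory Real

lemma aux_int_s14 (k : ℕ) (r : ℂ) (hr : 0 < r.re) :
    IntegrableOn (fun t : ℝ => (t : ℂ) ^ k * Complex.exp (-r * t)) (Set.Ioi 0) := by
  have h := integral_rpow_mul_exp_neg_mul_Ioi (a := (k : ℝ) + 1) (r := r.re) (by positivity) hr
  have h2 : IntegrableOn (fun t : ℝ => t ^ ((k : ℝ) + 1 - 1) * rexp (-(r.re * t))) (Set.Ioi 0) := by
    apply Integrable.of_integral_ne_zero
    rw [h]
    have := Real.Gamma_pos_of_pos (s := (k : ℝ) + 1) (by positivity)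
    positivity
  refine Integrable.mono h2 (Continuous.aestronglyMeasurable (by fun_prop)) ?_
  refine (ae_restrict_mem measurableSet_Ioi).mono fun t ht => ?_
  have ht : 0 < t := ht
  simp [Complex.norm_exp, abs_of_pos ht]

lemma aux_moment (k : ℕ) (r : ℂ) (hr : 0 < r.re) :
    ∫ t in Set.Ioi (0 : ℝ), (t : ℂ) ^ k * Complex.exp (-r * t) =
      (Nat.factorial k : ℂ) / r ^ (k + 1) := by
  have hr0 : r ≠ 0 := by rintro rfl; simp at hr
  induction k with
  | zero =>
    have := integral_exp_mul_complex_Ioi (a := -r) (by simpa using hr) 0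
    simp only [neg_mul] at this
    simp [this]
  | succ k ih =>
    have hd : ∀ t : ℝ, HasDerivAt (fun t : ℝ => (t : ℂ) ^ (k + 1) * Complex.exp (-r * t))
        ((k + 1 : ℂ) * ((t : ℂ) ^ k * Complex.exp (-r * t))
          - r * ((t : ℂ) ^ (k + 1) * Complex.exp (-r * t))) t := by
      intro t
      have h0 : HasDerivAt (fun t : ℝ => (t : ℂ)) 1 t := Complex.ofRealCLM.hasDerivAt
      have := (h0.pow (k + 1)).mul ((h0.const_mul (-r)).cexp)
      convert! this using 1
      simp
      ring
    have hi := ((aux_int_s14 k r hr).const_mul (k + 1 : ℂ)).sub ((aux_int_s14 (k + 1) r hr).const_mul r)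
    have ht : Filter.Tendsto (fun t : ℝ => (t : ℂ) ^ (k + 1) * Complex.exp (-r * t)) Filter.atTop
        (nhds 0) := by
      rw [tendsto_zero_iff_norm_tendsto_zero]
      have := tendsto_rpow_mul_exp_neg_mul_atTop_nhds_zero ((k + 1 : ℕ) : ℝ) r.re hr
      refine this.congr' ?_
      filter_upwards [Filter.eventually_gt_atTop 0] with t ht
      rw [Real.rpow_natCast]
      simp [Complex.norm_exp, abs_of_pos ht]
    have key := integral_Ioi_of_hasDerivAt_of_tendsto' (a := 0) (fun t _ => hd t) hi ht
    rw [integral_sub ((aux_int_s14 k r hr).const_mul (k + 1 : ℂ))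
      ((aux_int_s14 (k + 1) r hr).const_mul r), integral_const_mul, integral_const_mul, ih] at key
    simp only [Complex.ofReal_zero, ne_eq, Nat.add_eq_zero_iff, one_ne_zero, and_false,
      not_false_eq_true, zero_pow, zero_mul, sub_zero] at key
    rw [eq_div_iff (by positivity)]
    rw [sub_eq_zero, ← mul_div_assoc, div_eq_iff (by positivity)] at key
    rw [Nat.factorial_succ]
    push_cast
    rw [key]; ring

lemma aux_norm_sub (θ t : ℝ) :
    |Real.sin θ| ≤ ‖1 - (t : ℂ) * Complex.exp (Complex.I * θ)‖ := by
  rw [mul_comm Complex.I, Complex.exp_mul_I, ← Complex.ofReal_cos, ← Complex.ofReal_sin]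
  refine abs_le_of_sq_le_sq ?_ (norm_nonneg _)
  rw [Complex.sq_norm, Complex.normSq_apply]
  simp only [Complex.sub_re, Complex.one_re, Complex.mul_re, Complex.ofReal_re, Complex.add_re,
    Complex.I_re, mul_zero, Complex.ofReal_im, Complex.I_im, mul_one, sub_self, add_zero,
    Complex.add_im, Complex.mul_im, zero_mul, zero_add, Complex.sub_im, Complex.one_im, sub_zero]
  nlinarith [sq_nonneg (t - Real.cos θ), Real.sin_sq_add_cos_sq θ]

/-- integrand of the `n`-th remainder -/
noncomputable def remI (θ x : ℝ) (n : ℕ) (t : ℝ) : ℂ :=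
  ((t : ℂ) * Complex.exp (Complex.I * θ)) ^ n *
    Complex.exp (-(x : ℂ) * ((t : ℂ) * Complex.exp (Complex.I * θ))) /
      (1 - (t : ℂ) * Complex.exp (Complex.I * θ)) * Complex.exp (Complex.I * θ)

lemma re_pos_aux (θ x : ℝ) (hx : 0 < x) (hc : 0 < Real.cos θ) :
    0 < ((x : ℂ) * Complex.exp (Complex.I * θ)).re := by
  rw [mul_comm Complex.I, Complex.exp_mul_I, ← Complex.ofReal_cos, ← Complex.ofReal_sin]
  simp only [Complex.mul_re, Complex.ofReal_re, Complex.add_re,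
    Complex.I_re, mul_zero, Complex.ofReal_im, Complex.I_im, mul_one, sub_self, add_zero,
    zero_mul, sub_zero]
  positivity

lemma one_sub_ne (θ t : ℝ) (hs : Real.sin θ ≠ 0) :
    1 - (t : ℂ) * Complex.exp (Complex.I * θ) ≠ 0 := by
  rw [← norm_pos_iff]
  exact lt_of_lt_of_le (abs_pos.mpr hs) (aux_norm_sub θ t)

lemma remI_int (θ x : ℝ) (n : ℕ) (hx : 0 < x) (hc : 0 < Real.cos θ) (hs : Real.sin θ ≠ 0) :
    IntegrableOn (remI θ x n) (Set.Ioi 0) := by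
  have h := (aux_int_s14 n _ (re_pos_aux θ x hx hc)).norm.const_mul (|Real.sin θ|⁻¹)
  refine Integrable.mono' h ?_ (Filter.Eventually.of_forall fun t => ?_)
  · apply Continuous.aestronglyMeasurable
    unfold remI
    refine Continuous.mul (Continuous.div (by fun_prop) (by fun_prop) fun t => one_sub_ne θ t hs)
      continuous_const
  · have he : ‖Complex.exp (Complex.I * θ)‖ = 1 := by
      rw [mul_comm]; exact Complex.norm_exp_ofReal_mul_I θ
    unfold remI
    rw [norm_mul, norm_div, norm_mul, norm_pow, norm_mul, he, norm_mul, norm_pow, mul_one, mul_one,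
      div_eq_inv_mul]
    have e : -((x : ℂ) * Complex.exp (Complex.I * θ)) * t
      = -(x : ℂ) * ((t : ℂ) * Complex.exp (Complex.I * θ)) := by ring
    rw [e]
    gcongr
    · exact aux_norm_sub θ t

lemma remI_sum (θ x : ℝ) (n : ℕ) (hx : 0 < x) (hc : 0 < Real.cos θ) (hs : Real.sin θ ≠ 0) :
    lateralBorelSum θ x - ∑ k ∈ Finset.range n, (Nat.factorial k : ℂ) / (x : ℂ) ^ (k + 1)
      = ∫ t in Set.Ioi (0 : ℝ), remI θ x n t := by
  induction n with
  | zero => simp [lateralBorelSum, remI]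
  | succ n ih =>
    rw [Finset.sum_range_succ, ← sub_sub, ih, sub_eq_iff_eq_add,
      ← sub_eq_iff_eq_add', ← integral_sub (remI_int θ x n hx hc hs) (remI_int θ x (n + 1) hx hc hs)]
    have e : ∀ t : ℝ, remI θ x n t - remI θ x (n + 1) t = Complex.exp (Complex.I * θ) ^ (n + 1) *
        ((t : ℂ) ^ n * Complex.exp (-((x : ℂ) * Complex.exp (Complex.I * θ)) * t)) := by
      intro t
      have := one_sub_ne θ t hs
      unfold remI
      rw [show -((x : ℂ) * Complex.exp (Complex.I * θ)) * t
        = -(x : ℂ) * ((t : ℂ) * Complex.exp (Complex.I * θ)) by ring]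
      generalize Complex.exp (-(x : ℂ) * ((t : ℂ) * Complex.exp (Complex.I * θ))) = E
      generalize Complex.exp (Complex.I * θ) = w at *
      field_simp
      ring
    simp_rw [e]
    rw [integral_const_mul, aux_moment _ _ (re_pos_aux θ x hx hc)]
    have := Complex.exp_ne_zero (Complex.I * θ)
    have : (x : ℂ) ≠ 0 := by exact_mod_cast hx.ne'
    rw [mul_pow]
    field_simp

/-- the saddle function -/
noncomputable def psi (m x : ℝ) (z : ℂ) : ℂ := Complex.exp (m * z - x * Complex.exp z)

lemma remI_exp (θ x : ℝ) (n : ℕ) (s : ℝ) :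
    |rexp s| • remI θ x n (rexp s) =
      - (psi (n + 1 / 2) x (s + θ * Complex.I) /
        (2 * Complex.sinh ((s + θ * Complex.I) / 2))) := by
  have e1 : ((rexp s : ℝ) : ℂ) * Complex.exp (Complex.I * θ)
     = Complex.exp (s + θ * Complex.I) := by
    rw [Complex.exp_add, Complex.ofReal_exp, mul_comm Complex.I]
  have e2 : 1 - Complex.exp (s + θ * Complex.I) = - (Complex.exp ((s + θ * Complex.I) / 2) *
      (2 * Complex.sinh ((s + θ * Complex.I) / 2))) := by
    rw [Complex.two_sinh, mul_sub, ← Complex.exp_add, ← Complex.exp_add]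
    simp
  have e3 : psi (n + 1 / 2) x (s + θ * Complex.I) * Complex.exp ((s + θ * Complex.I) / 2) =
      Complex.exp (s + θ * Complex.I) ^ n * Complex.exp (-x * Complex.exp (s + θ * Complex.I)) *
       Complex.exp (s + θ * Complex.I) := by
    unfold psi
    rw [← Complex.exp_nat_mul, ← Complex.exp_add, ← Complex.exp_add, ← Complex.exp_add]
    congr 1
    push_cast
    ring
  have e4 : |rexp s| • remI θ x n (rexp s) = Complex.exp (s + θ * Complex.I) ^ n *
      Complex.exp (-x * Complex.exp (s + θ * Complex.I)) * Complex.exp (s + θ * Complex.I) /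
      (1 - Complex.exp (s + θ * Complex.I)) := by
    unfold remI
    rw [abs_of_pos (Real.exp_pos s), Complex.real_smul, e1]
    have : ∀ a P Q w : ℂ, a * (P / Q * w) = P * (a * w) / Q := by intros; ring
    rw [this, e1]
  rw [e4, ← e3, e2, mul_comm, div_neg, mul_div_mul_left _ _ (Complex.exp_ne_zero _)]

lemma remI_cov (θ x : ℝ) (n : ℕ) (hx : 0 < x) (hc : 0 < Real.cos θ) (hs : Real.sin θ ≠ 0) :
    Integrable (fun s : ℝ => psi (n + 1 / 2) x (s + θ * Complex.I) /
        (2 * Complex.sinh ((s + θ * Complex.I) / 2))) ∧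
    ∫ t in Set.Ioi (0 : ℝ), remI θ x n t = - ∫ s : ℝ, psi (n + 1 / 2) x (s + θ * Complex.I) /
        (2 * Complex.sinh ((s + θ * Complex.I) / 2)) := by
  have himg : Real.exp '' Set.univ = Set.Ioi 0 := by simp
  have hd : ∀ s ∈ (Set.univ : Set ℝ), HasDerivWithinAt Real.exp (Real.exp s) Set.univ s :=
    fun s _ => (Real.hasDerivAt_exp s).hasDerivWithinAt
  have hinj : Set.InjOn Real.exp Set.univ := Real.exp_injective.injOn
  constructor
  · have := (integrableOn_image_iff_integrableOn_abs_deriv_smul MeasurableSet.univ hd hinj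
      (remI θ x n)).1 (by rw [himg]; exact remI_int θ x n hx hc hs)
    simp_rw [remI_exp] at this
    simpa using (integrableOn_univ.1 this).neg
  · have := integral_image_eq_integral_abs_deriv_smul MeasurableSet.univ hd hinj (remI θ x n)
    simp_rw [remI_exp] at this
    rw [← himg, this, setIntegral_univ, integral_neg]
/-- the denominator -/
noncomputable def kk (z : ℂ) : ℂ := 2 * Complex.sinh (z / 2)

/-- the numerator -/
noncomputable def nn (m x : ℝ) (z : ℂ) : ℂ := psi m x z - psi m x (-z)

/-- the quotient with its removable singularity removed -/
noncomputable def hs (m x : ℝ) (z : ℂ) : ℂ := dslope (nn m x) 0 z / dslope kk 0 z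

lemma hs_eq (m x : ℝ) (z : ℂ) (hz : z ≠ 0) : hs m x z = nn m x z / kk z := by
  unfold hs
  rw [dslope_of_ne _ hz, dslope_of_ne _ hz, slope_def_field, slope_def_field]
  have h1 : nn m x 0 = 0 := by simp [nn]
  have h2 : kk 0 = 0 := by simp [kk]
  rw [h1, h2]
  simp only [sub_zero]
  rw [div_div_div_cancel_right₀ hz]

lemma kk_ne (z : ℂ) (hz : z ≠ 0) (h : |z.im| < π) : kk z ≠ 0 := by
  intro h0
  have h1 : Complex.exp z = 1 := by
    have : kk z * Complex.exp (z / 2) = Complex.exp z - 1 := by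
      unfold kk
      rw [Complex.two_sinh, sub_mul, ← Complex.exp_add, ← Complex.exp_add]
      simp
    rw [h0, zero_mul] at this
    exact (sub_eq_zero.1 this.symm)
  obtain ⟨n, hn⟩ := Complex.exp_eq_one_iff.1 h1
  have him : z.im = n * (2 * π) := by rw [hn]; simp
  have hn0 : n = 0 := by
    rw [him, abs_lt] at h
    have hp := Real.pi_pos
    have a : (n : ℝ) < 1 := by by_contra hc; push Not at hc; nlinarith
    have b : (-1 : ℝ) < n := by by_contra hc; push Not at hc; nlinarith
    have a' : n < 1 := by exact_mod_cast a
    have b' : -1 < n := by exact_mod_cast b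
    omega
  apply hz
  rw [hn, hn0]; simp

lemma nn_diff (m x : ℝ) : Differentiable ℂ (nn m x) := by
  unfold nn psi; fun_prop

lemma kk_diff : Differentiable ℂ kk := by
  unfold kk; fun_prop

lemma hs_diffAt (m x : ℝ) (z : ℂ) (h : |z.im| < π) : DifferentiableAt ℂ (hs m x) z := by
  have d1 : DifferentiableOn ℂ (dslope (nn m x) 0) Set.univ :=
    (Complex.differentiableOn_dslope Filter.univ_mem).2 (nn_diff m x).differentiableOn
  have d2 : DifferentiableOn ℂ (dslope kk 0) Set.univ :=
    (Complex.differentiableOn_dslope Filter.univ_mem).2 kk_diff.differentiableOn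
  refine DifferentiableAt.div (d1.differentiableAt Filter.univ_mem)
    (d2.differentiableAt Filter.univ_mem) ?_
  by_cases hz : z = 0
  · subst hz
    rw [dslope_same]
    have : HasDerivAt kk 1 0 := by
      have := (((hasDerivAt_id (0 : ℂ)).div_const 2).csinh).const_mul 2
      convert! this using 1
      simp
    rw [this.deriv]; exact one_ne_zero
  · rw [dslope_of_ne _ hz, slope_def_field]
    have h2 : kk 0 = 0 := by simp [kk]
    rw [h2]
    simp only [sub_zero]
    exact div_ne_zero (kk_ne z hz h) hz

lemma kk_norm (z : ℂ) : |z.re| ≤ ‖kk z‖ := by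
  unfold kk
  rw [Complex.two_sinh]
  have h1 := abs_norm_sub_norm_le (Complex.exp (z / 2)) (Complex.exp (-(z / 2)))
  rw [Complex.norm_exp, Complex.norm_exp] at h1
  refine le_trans ?_ h1
  have e1 : (z / 2).re = z.re / 2 := by simp
  have e2 : (-(z / 2)).re = -(z.re / 2) := by simp
  rw [e1, e2]
  have e3 : rexp (z.re / 2) - rexp (-(z.re / 2)) = 2 * Real.sinh (z.re / 2) := by
    rw [Real.sinh_eq]; ring
  rw [e3]
  rcases le_total 0 z.re with h | h
  · have := Real.self_le_sinh_iff.2 (by linarith : 0 ≤ z.re / 2)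
    rw [abs_of_nonneg h]
    exact le_trans (by linarith) (le_abs_self _)
  · have := Real.sinh_le_self_iff.2 (by linarith : z.re / 2 ≤ 0)
    rw [abs_of_nonpos h]
    exact le_trans (by linarith) (neg_le_abs _)

lemma psi_norm (m x u v : ℝ) : ‖psi m x (u + v * Complex.I)‖
    = rexp (m * u - x * (rexp u * Real.cos v)) := by
  unfold psi
  rw [Complex.norm_exp]
  congr 1
  rw [Complex.exp_add, Complex.exp_mul_I, ← Complex.ofReal_exp, ← Complex.ofReal_cos,
    ← Complex.ofReal_sin]
  simp only [Complex.sub_re, Complex.mul_re, Complex.ofReal_re, Complex.add_re,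
    Complex.I_re, mul_zero, Complex.ofReal_im, Complex.I_im, mul_one, sub_self, add_zero,
    zero_mul, sub_zero]

lemma hs_vert (m x δ T u v : ℝ) (hx : 0 < x) (hT : 1 ≤ T) (hu : u = T ∨ u = -T)
    (hv : v ∈ Set.Icc 0 δ) (hδ : δ < π / 2) :
    ‖hs m x (u + v * Complex.I)‖ ≤ rexp (m * T - x * (rexp T * Real.cos δ)) + rexp (-(m * T)) := by
  have hcd : Real.cos δ ≤ Real.cos v := Real.cos_le_cos_of_nonneg_of_le_pi hv.1 (by linarith [Real.pi_pos]) hv.2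
  have hcd0 : 0 ≤ Real.cos δ := Real.cos_nonneg_of_neg_pi_div_two_le_of_le (by linarith [Real.pi_pos, hv.1, hv.2]) hδ.le
  have hre : ((u : ℂ) + v * Complex.I).re = u := by simp
  have hau : |u| = T := by
    rcases hu with h | h <;> simp [h, abs_of_pos (by linarith : 0 < T)]
  have hz : (u : ℂ) + v * Complex.I ≠ 0 := by
    intro h
    rw [h] at hre
    simp at hre
    rw [← hre] at hau
    simp at hau
    linarith
  have hk : 1 ≤ ‖kk (u + v * Complex.I)‖ := by
    have := kk_norm (u + v * Complex.I)
    rw [hre, hau] at this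
    linarith
  have hneg : -((u : ℂ) + v * Complex.I) = ((-u : ℝ) : ℂ) + ((-v : ℝ) : ℂ) * Complex.I := by
    push_cast; ring
  have hA : rexp (m * T - x * (rexp T * Real.cos v)) ≤ rexp (m * T - x * (rexp T * Real.cos δ)) := by
    gcongr
  have hB : rexp (m * -T - x * (rexp (-T) * Real.cos v)) ≤ rexp (-(m * T)) := by
    apply Real.exp_le_exp.2
    have : 0 ≤ x * (rexp (-T) * Real.cos v) := by
      have := hcd0.trans hcd
      positivity
    linarith
  rw [hs_eq m x _ hz, norm_div]
  refine (div_le_self (norm_nonneg _) hk).trans ?_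
  unfold nn
  refine (norm_sub_le _ _).trans ?_
  rw [hneg, psi_norm, psi_norm, Real.cos_neg]
  rcases hu with h | h
  · rw [h]; linarith
  · rw [h, neg_neg]; linarith

lemma B_tendsto (m c : ℝ) (hm : 0 < m) (hc : 0 < c) :
    Filter.Tendsto (fun T : ℝ => rexp (m * T - c * rexp T) + rexp (-(m * T))) Filter.atTop
      (nhds 0) := by
  have h2 : Filter.Tendsto (fun T : ℝ => rexp (-(m * T))) Filter.atTop (nhds 0) :=
    Real.tendsto_exp_neg_atTop_nhds_zero.comp (Filter.tendsto_id.const_mul_atTop hm)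
  have h1 : Filter.Tendsto (fun T : ℝ => rexp (m * T - c * rexp T)) Filter.atTop (nhds 0) := by
    refine squeeze_zero' (Filter.Eventually.of_forall fun T => (Real.exp_pos _).le) ?_ h2
    have := (Real.tendsto_exp_div_pow_atTop 1).eventually_ge_atTop (2 * m / c)
    filter_upwards [this, Filter.eventually_gt_atTop 0] with T hT hT0
    rw [pow_one, div_le_div_iff₀ hc hT0] at hT
    apply Real.exp_le_exp.2
    linarith
  simpa using h1.add h2

lemma hs_shift (m x δ : ℝ) (hm : 0 < m) (hx : 0 < x) (hδ0 : 0 < δ) (hδ : δ < π / 2)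
    (hi0 : Integrable (fun s : ℝ => hs m x s))
    (hi1 : Integrable (fun s : ℝ => hs m x (s + δ * Complex.I))) :
    ∫ s : ℝ, hs m x (s + δ * Complex.I) = ∫ s : ℝ, hs m x s := by
  have hrect : ∀ T : ℝ, (∫ s : ℝ in (-T)..T, hs m x s) - (∫ s : ℝ in (-T)..T, hs m x (s + δ * Complex.I))
      + Complex.I • (∫ v : ℝ in (0)..δ, hs m x (T + v * Complex.I))
      - Complex.I • (∫ v : ℝ in (0)..δ, hs m x ((-T : ℝ) + v * Complex.I)) = 0 := by
    intro T
    have := Complex.integral_boundary_rect_eq_zero_of_differentiableOn (hs m x) ((-T : ℝ) : ℂ)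
      (T + δ * Complex.I) ?_
    · simpa using this
    · intro z hz
      refine (hs_diffAt m x z ?_).differentiableWithinAt
      have := hz.2
      simp [Set.uIcc_of_le hδ0.le] at this
      rw [abs_lt]
      constructor <;> linarith [Real.pi_pos, this.1, this.2]
  have l0 := intervalIntegral_tendsto_integral hi0 Filter.tendsto_neg_atTop_atBot Filter.tendsto_id
  have l1 := intervalIntegral_tendsto_integral hi1 Filter.tendsto_neg_atTop_atBot Filter.tendsto_id
  have hcos : 0 < Real.cos δ := Real.cos_pos_of_mem_Ioo ⟨by linarith [Real.pi_pos], hδ⟩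
  have hB := (B_tendsto m (x * Real.cos δ) hm (by positivity)).mul_const δ
  rw [zero_mul] at hB
  have hv : ∀ ε : ℝ → ℝ, (∀ T, ε T = T ∨ ε T = -T) → Filter.Tendsto
      (fun T : ℝ => Complex.I • ∫ v : ℝ in (0)..δ, hs m x (ε T + v * Complex.I)) Filter.atTop (nhds 0) := by
    intro ε hε
    refine squeeze_zero_norm' ?_ hB
    filter_upwards [Filter.eventually_ge_atTop 1] with T hT
    rw [norm_smul, Complex.norm_I, one_mul]
    have := intervalIntegral.norm_integral_le_of_norm_le_const (a := 0) (b := δ)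
      (f := fun v : ℝ => hs m x (ε T + v * Complex.I))
      (C := rexp (m * T - x * Real.cos δ * rexp T) + rexp (-(m * T))) ?_
    · rwa [sub_zero, abs_of_pos hδ0] at this
    · intro v hv
      rw [Set.uIoc_of_le hδ0.le] at hv
      have := hs_vert m x δ T (ε T) v hx hT (hε T) ⟨hv.1.le, hv.2⟩ hδ
      rwa [show x * (rexp T * Real.cos δ) = x * Real.cos δ * rexp T by ring] at this
  have key := ((l0.sub l1).add (hv (fun T => T) (fun T => Or.inl rfl))).sub
    (hv (fun T => -T) (fun T => Or.inr rfl))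
  have key2 : Filter.Tendsto (fun _ : ℝ => (0 : ℂ)) Filter.atTop _ := key.congr hrect
  have := tendsto_nhds_unique key2 tendsto_const_nhds
  simp only [add_zero, sub_zero] at this
  exact (sub_eq_zero.1 this).symm
lemma exp_diff (A B M : ℝ) (hA : A ≤ M) (hB : B ≤ M) :
    |rexp A - rexp B| ≤ |A - B| * rexp M := by
  wlog h : B ≤ A generalizing A B
  · rw [abs_sub_comm, abs_sub_comm A]
    exact this B A hB hA (le_of_not_ge h)
  have h1 : rexp B ≤ rexp A := Real.exp_le_exp.2 h
  have h2 : rexp A ≤ rexp M := Real.exp_le_exp.2 hA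
  rw [abs_of_nonneg (by linarith), abs_of_nonneg (by linarith)]
  have h3 := Real.add_one_le_exp (B - A)
  have h4 : rexp B = rexp A * rexp (B - A) := by rw [← Real.exp_add]; congr 1; ring
  have := Real.exp_pos A
  rw [h4]
  nlinarith

lemma exp_small (s : ℝ) (h0 : 0 ≤ s) (h1 : s ≤ 1) :
    1 - s + s ^ 2 / 4 ≤ rexp (-s) ∧ 1 - s + s ^ 2 / 2 - 2 / 9 * s ^ 3 ≤ rexp (-s) ∧
    rexp s ≤ 1 + s + s ^ 2 / 2 + 2 / 9 * s ^ 3 := by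
  have a := Real.exp_bound (x := s) (by rwa [abs_of_nonneg h0]) (n := 3) (by norm_num)
  have b := Real.exp_bound (x := -s) (by rwa [abs_neg, abs_of_nonneg h0]) (n := 3) (by norm_num)
  rw [abs_neg] at b
  rw [abs_of_nonneg h0] at a b
  simp [Finset.sum_range_succ, Nat.factorial] at a b
  rw [abs_le] at a b
  have hs3 : s ^ 3 ≤ s ^ 2 := by nlinarith [sq_nonneg s]
  have := sq_nonneg s
  refine ⟨?_, ?_, ?_⟩ <;> linarith [a.1, a.2, b.1, b.2]

lemma exp_large (s : ℝ) (h1 : 1 ≤ s) : s / 3 ≤ rexp (-s) - 1 + s := by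
  rcases le_total (3 / 2) s with h | h
  · linarith [Real.exp_pos (-s)]
  · have e : rexp (-s) * rexp 1 = rexp (1 - s) := by rw [← Real.exp_add]; congr 1; ring
    have h2 := Real.add_one_le_exp (1 - s)
    have h3 : rexp 1 < 3 := by linarith [Real.exp_one_lt_d9]
    have := Real.exp_pos (-s)
    nlinarith

lemma real_bound (m x s : ℝ) (hx : 1 ≤ x) (hm1 : x + 1 / 2 ≤ m) (hm2 : m ≤ x + 3 / 2)
    (hs : 0 < s) : |rexp (m * s - x * rexp s) - rexp (m * (-s) - x * rexp (-s))| / s ≤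
      6 * rexp (9 / 4) * rexp (-x) * (rexp (-(x / 6) * s ^ 2) + rexp (-(x / 3) * s)) := by
  have hq := Real.quadratic_le_exp_of_nonneg hs.le
  rw [div_le_iff₀ hs]
  have p1 := Real.exp_pos (-(x / 6) * s ^ 2)
  have p2 := Real.exp_pos (-(x / 3) * s)
  rcases le_total s 1 with h | h
  · obtain ⟨a, b, c⟩ := exp_small s hs.le h
    have hM := exp_diff (m * s - x * rexp s) (m * (-s) - x * rexp (-s))
      (-x + 9 / 4 - x * s ^ 2 / 4) (by nlinarith [sq_nonneg s]) (by nlinarith [sq_nonneg s])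
    have hD : |m * s - x * rexp s - (m * (-s) - x * rexp (-s))| ≤ s * (3 + x * s ^ 2 / 2) := by
      have hsh : s ≤ Real.sinh s := Real.self_le_sinh_iff.2 hs.le
      rw [Real.sinh_eq] at hsh
      have e1 : 2 * s * x ≤ x * (rexp s - rexp (-s)) := by nlinarith
      have e2 : x * (rexp s - rexp (-s)) ≤ x * (2 * s + 4 / 9 * s ^ 3) := by
        gcongr; linarith
      have e3 : 0 ≤ x * s ^ 3 := by positivity
      rw [abs_le]
      constructor <;> nlinarith
    have h6 : 3 + x * s ^ 2 / 2 ≤ 6 * rexp (x * s ^ 2 / 12) := by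
      have := Real.add_one_le_exp (x * s ^ 2 / 12)
      linarith
    have hE : rexp (-x + 9 / 4 - x * s ^ 2 / 4) * rexp (x * s ^ 2 / 12) =
        rexp (9 / 4) * rexp (-x) * rexp (-(x / 6) * s ^ 2) := by
      rw [← Real.exp_add, ← Real.exp_add, ← Real.exp_add]; congr 1; ring
    calc _ ≤ _ := hM
      _ ≤ s * (6 * rexp (x * s ^ 2 / 12)) * rexp (-x + 9 / 4 - x * s ^ 2 / 4) := by
          gcongr; exact hD.trans (by gcongr)
      _ = s * 6 * (rexp (-x + 9 / 4 - x * s ^ 2 / 4) * rexp (x * s ^ 2 / 12)) := by ring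
      _ = 6 * rexp (9 / 4) * rexp (-x) * (rexp (-(x / 6) * s ^ 2) + 0) * s := by rw [hE]; ring
      _ ≤ _ := by gcongr
  · have hA : rexp (m * s - x * rexp s) ≤ rexp (9 / 4) * rexp (-x) * rexp (-(x / 6) * s ^ 2) := by
      rw [← Real.exp_add, ← Real.exp_add]
      apply Real.exp_le_exp.2
      nlinarith [sq_nonneg (s / 2 - 3 / 2), sq_nonneg s]
    have hB : rexp (m * (-s) - x * rexp (-s)) ≤ rexp (9 / 4) * rexp (-x) * rexp (-(x / 3) * s) := by
      rw [← Real.exp_add, ← Real.exp_add]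
      apply Real.exp_le_exp.2
      have := exp_large s h
      nlinarith
    have hC : |rexp (m * s - x * rexp s) - rexp (m * (-s) - x * rexp (-s))| ≤
        rexp (m * s - x * rexp s) + rexp (m * (-s) - x * rexp (-s)) := by
      have := Real.exp_pos (m * s - x * rexp s)
      have := Real.exp_pos (m * (-s) - x * rexp (-s))
      rw [abs_le]; constructor <;> linarith
    have hK : 0 ≤ rexp (9 / 4) * rexp (-x) * (rexp (-(x / 6) * s ^ 2) + rexp (-(x / 3) * s)) := by
      positivity
    nlinarith

lemma hs_bound (m x s : ℝ) (hx : 1 ≤ x) (hm1 : x + 1 / 2 ≤ m) (hm2 : m ≤ x + 3 / 2)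
    (h0 : s ≠ 0) : ‖hs m x s‖ ≤
      6 * rexp (9 / 4) * rexp (-x) * (rexp (-(x / 6) * s ^ 2) + rexp (-(x / 3) * |s|)) := by
  have e : ∀ u : ℝ, psi m x u = ((rexp (m * u - x * rexp u) : ℝ) : ℂ) := by
    intro u; unfold psi; push_cast; rfl
  have e' : ‖nn m x s‖ = |rexp (m * s - x * rexp s) - rexp (m * (-s) - x * rexp (-s))| := by
    unfold nn
    rw [← Complex.ofReal_neg, e, e, ← Complex.ofReal_sub, Complex.norm_real, Real.norm_eq_abs]
  rw [hs_eq m x s (by exact_mod_cast h0), norm_div, e']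
  have hk := kk_norm s
  rw [Complex.ofReal_re] at hk
  have hp : 0 < |s| := abs_pos.2 h0
  refine (div_le_div_of_nonneg_left (abs_nonneg _) hp hk).trans ?_
  have := real_bound m x |s| hx hm1 hm2 hp
  rw [sq_abs] at this
  refine le_trans (le_of_eq ?_) this
  congr 1
  rcases abs_cases s with h | h
  · rw [h.1]
  · rw [h.1, neg_neg, abs_sub_comm]

lemma bnd_int (x : ℝ) (hx : 1 ≤ x) :
    Integrable (fun s : ℝ => rexp (-(x / 6) * s ^ 2) + rexp (-(x / 3) * |s|)) ∧
    ∫ s : ℝ, (rexp (-(x / 6) * s ^ 2) + rexp (-(x / 3) * |s|)) ≤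
      (√(6 * π) + 6) * x ^ (-(1 : ℝ) / 2) := by
  have hx0 : 0 < x := by linarith
  have i1 : ∫ s : ℝ, rexp (-(x / 6) * s ^ 2) = √(π / (x / 6)) := integral_gaussian _
  have j1 : Integrable (fun s : ℝ => rexp (-(x / 6) * s ^ 2)) :=
    integrable_exp_neg_mul_sq (by positivity)
  have i2 : ∫ s : ℝ, rexp (-(x / 3) * |s|) = 6 / x := by
    rw [integral_comp_abs (f := fun s => rexp (-(x / 3) * s)),
      integral_exp_mul_Ioi (by linarith)]
    simp
    field_simp
    norm_num
  have j2 : Integrable (fun s : ℝ => rexp (-(x / 3) * |s|)) := by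
    apply Integrable.of_integral_ne_zero
    rw [i2]; positivity
  refine ⟨j1.add j2, ?_⟩
  rw [integral_add j1 j2, i1, i2]
  have e : x ^ (-(1 : ℝ) / 2) = 1 / √x := by
    rw [neg_div, Real.rpow_neg hx0.le, ← Real.sqrt_eq_rpow, one_div]
  have e2 : √(π / (x / 6)) = √(6 * π) * (1 / √x) := by
    rw [mul_one_div, ← Real.sqrt_div (by positivity)]
    congr 1; field_simp
  have e3 : 6 / x ≤ 6 * (1 / √x) := by
    rw [mul_one_div]
    gcongr
    rw [Real.sqrt_le_left hx0.le]
    nlinarith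
  rw [e, e2, add_mul]
  linarith

/-- On the Stokes line, the balanced average `y = (F_+ + F_-)/2` of the two
lateral Borel sums differs from the series `∑ k! x^{-k-1}` optimally
truncated at its least term (index `⌊x⌋`) by at most the order of the least
term, `O(x^{-1/2} e^{-x})`. -/
theorem stmt_14 (δ : ℝ) (hδ : δ ∈ Set.Ioo 0 (π / 2))
    (y : ℝ → ℂ)
    (hy : ∀ x : ℝ, y x = (lateralBorelSum δ x + lateralBorelSum (-δ) x) / 2) :
    ∃ C : ℝ, 0 < C ∧ ∀ x : ℝ, 1 ≤ x →
      ‖y x - ∑ k ∈ Finset.range (⌊x⌋₊ + 1),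
          (Nat.factorial k : ℂ) / (x : ℂ) ^ (k + 1)‖ ≤
        C * x ^ (-(1 : ℝ) / 2) * Real.exp (-x) := by
  obtain ⟨hδ0, hδ1⟩ := hδ
  refine ⟨6 * rexp (9 / 4) * (√(6 * π) + 6), by positivity, fun x hx => ?_⟩
  have hx0 : 0 < x := by linarith
  have hcos : 0 < Real.cos δ := Real.cos_pos_of_mem_Ioo ⟨by linarith [Real.pi_pos], hδ1⟩
  have hsin : 0 < Real.sin δ := Real.sin_pos_of_pos_of_lt_pi hδ0 (by linarith [Real.pi_pos])
  have hcos' : 0 < Real.cos (-δ) := by rwa [Real.cos_neg]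
  have hsin' : Real.sin (-δ) ≠ 0 := by rw [Real.sin_neg]; linarith
  rw [hy]
  set n : ℕ := ⌊x⌋₊ + 1 with hn
  set m : ℝ := (n : ℝ) + 1 / 2 with hm
  have hf1 := Nat.floor_le hx0.le
  have hf2 := Nat.lt_floor_add_one x
  have hm1 : x + 1 / 2 ≤ m := by rw [hm, hn]; push_cast; linarith
  have hm2 : m ≤ x + 3 / 2 := by rw [hm, hn]; push_cast; linarith
  obtain ⟨I1, E1⟩ := remI_cov δ x n hx0 hcos hsin.ne'
  obtain ⟨I2, E2⟩ := remI_cov (-δ) x n hx0 hcos' hsin'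
  rw [← remI_sum δ x n hx0 hcos hsin.ne'] at E1
  rw [← remI_sum (-δ) x n hx0 hcos' hsin'] at E2
  have I2' := I2.comp_neg
  rw [← integral_neg_eq_self] at E2
  have ec : ∀ s : ℝ, ((-s : ℝ) : ℂ) + ((-δ : ℝ) : ℂ) * Complex.I = -(s + δ * Complex.I) := by
    intro s; push_cast; ring
  simp only [ec] at I2' E2
  have hne : ∀ s : ℝ, (s : ℂ) + δ * Complex.I ≠ 0 := by
    intro s h
    have := congrArg Complex.im h
    simp at this
    linarith
  have hsplit : ∀ s : ℝ, hs m x (s + δ * Complex.I) =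
      psi m x (s + δ * Complex.I) / (2 * Complex.sinh ((s + δ * Complex.I) / 2)) +
      psi m x (-(s + δ * Complex.I)) / (2 * Complex.sinh (-(s + δ * Complex.I) / 2)) := by
    intro s
    rw [hs_eq m x _ (hne s), neg_div, Complex.sinh_neg]
    unfold nn kk
    rw [mul_neg, div_neg, sub_div, sub_eq_add_neg]
  have hi1 : Integrable (fun s : ℝ => hs m x (s + δ * Complex.I)) := by
    simp_rw [hsplit]
    exact I1.add I2'
  obtain ⟨jb, ib⟩ := bnd_int x hx
  have hbd : ∀ᵐ s : ℝ, ‖hs m x s‖ ≤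
      6 * rexp (9 / 4) * rexp (-x) * (rexp (-(x / 6) * s ^ 2) + rexp (-(x / 3) * |s|)) := by
    have : ∀ᵐ s : ℝ, s ≠ 0 := by simp [ae_iff]
    filter_upwards [this] with s h
    exact hs_bound m x s hx hm1 hm2 h
  have hcont : Continuous (fun s : ℝ => hs m x s) := by
    rw [continuous_iff_continuousAt]
    intro s
    exact ContinuousAt.comp (f := fun s : ℝ => (s : ℂ))
      (hs_diffAt m x s (by simp [Real.pi_pos])).continuousAt Complex.continuous_ofReal.continuousAt
  have hi0 : Integrable (fun s : ℝ => hs m x s) :=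
    (jb.const_mul _).mono' hcont.aestronglyMeasurable hbd
  have hsh := hs_shift m x δ (by linarith) hx0 hδ0 hδ1 hi0 hi1
  simp_rw [hsplit] at hsh
  rw [integral_add I1 I2'] at hsh
  have hfin : (lateralBorelSum δ x + lateralBorelSum (-δ) x) / 2 -
      ∑ k ∈ Finset.range n, (Nat.factorial k : ℂ) / (x : ℂ) ^ (k + 1)
      = - (1 / 2 : ℂ) * ∫ s : ℝ, hs m x s := by
    rw [← hsh]
    linear_combination (1 / 2 : ℂ) * E1 + (1 / 2 : ℂ) * E2
  rw [hfin, norm_mul]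
  have hnb := norm_integral_le_of_norm_le (jb.const_mul _) hbd
  rw [integral_const_mul] at hnb
  have hh : ‖(-(1 / 2 : ℂ))‖ ≤ 1 := by norm_num
  calc _ ≤ 1 * ‖∫ s : ℝ, hs m x s‖ := by gcongr
    _ ≤ 6 * rexp (9 / 4) * rexp (-x) * ((√(6 * π) + 6) * x ^ (-(1 : ℝ) / 2)) := by
        rw [one_mul]; exact hnb.trans (by gcongr)
    _ = _ := by ring
end
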